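/- arXiv:2206.01152 — 4 statements merged into one kernel-verified Lean document; each statement's English description precedes it below -/
import Mathlib

section
/- Let 𝒳_1, …, 𝒳_p be finite sets each of cardinality at least 2. For DAGs G and G' on Fin p, the set of probability mass functions on ∏_i 𝒳_i that factorize according to G equals the set of probability mass functions that factorize according to G' if and only if G and G' are Markov equivalent, i.e., I(G) = I(G'). -/
namespace CausalDiscovery

variable {V : Type*}

/-- A relation is acyclic if it has no directed cycles. -/
def Acyclic (E : V → V → Prop) : Prop :=
  ∀ v, ¬ Relation.TransGen E v v

/-- `i` and `j` are adjacent (joined by an edge in either direction). -/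
def Adj (E : V → V → Prop) (i j : V) : Prop :=
  E i j ∨ E j i

/-- `j` is a descendant of `i`, i.e. reachable from `i` by a directed path. -/
def Desc (E : V → V → Prop) (i j : V) : Prop :=
  Relation.ReflTransGen E i j

/-- `f 0, f 1, …, f n` is a path between `i` and `j`: the vertices are distinct and
consecutive vertices are adjacent. -/
def IsPath (E : V → V → Prop) (n : ℕ) (f : ℕ → V) (i j : V) : Prop :=
  0 < n ∧ f 0 = i ∧ f n = j ∧
    (∀ s t, s ≤ n → t ≤ n → f s = f t → s = t) ∧
    ∀ t, t < n → Adj E (f t) (f (t + 1))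

/-- The vertex at (interior) position `t` of the path `f` is a collider:
both edges of the path at that vertex point into it. -/
def ColliderAt (E : V → V → Prop) (f : ℕ → V) (t : ℕ) : Prop :=
  E (f (t - 1)) (f t) ∧ E (f (t + 1)) (f t)

/-- The path `f 0, …, f n` d-connects its endpoints given `C`: every non-collider
interior vertex is outside `C`, every collider is in `C` or has a descendant in `C`. -/
def DConn (E : V → V → Prop) (n : ℕ) (f : ℕ → V) (C : Finset V) : Prop :=
  ∀ t, 0 < t → t < n →
    (ColliderAt E f t → f t ∈ C ∨ ∃ d ∈ C, Desc E (f t) d) ∧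
    (¬ ColliderAt E f t → f t ∉ C)

/-- `i` and `j` are d-separated given `C`: no path between them d-connects given `C`. -/
def DSep (E : V → V → Prop) (i j : V) (C : Finset V) : Prop :=
  ∀ n f, IsPath E n f i j → ¬ DConn E n f C

/-- The independence model `I(E)`: all d-separation triples `(i, j, C)` with `i, j`
distinct and `C ⊆ V \ {i, j}`. -/
def Indep (E : V → V → Prop) : Set (V × V × Finset V) :=
  {x | x.1 ≠ x.2.1 ∧ x.1 ∉ x.2.2 ∧ x.2.1 ∉ x.2.2 ∧ DSep E x.1 x.2.1 x.2.2}

/-- Two graphs are Markov equivalent if they have the same independence model. -/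
def MarkovEquiv (E E' : V → V → Prop) : Prop :=
  Indep E = Indep E'

/-- Two graphs have the same skeleton if they have the same adjacencies. -/
def SameSkeleton (E E' : V → V → Prop) : Prop :=
  ∀ i j, Adj E i j ↔ Adj E' i j

/-- The v-structures of a graph: triples `(i, j, k)` with `i → j ← k` and `i, k`
not adjacent. -/
def VStruct (E : V → V → Prop) : Set (V × V × V) :=
  {x | E x.1 x.2.1 ∧ E x.2.2 x.2.1 ∧ x.1 ≠ x.2.2 ∧ ¬ Adj E x.1 x.2.2}


variable {p : ℕ} {𝒳 : Fin p → Type*} [∀ i, Fintype (𝒳 i)]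

/-- `P` is a probability mass function: nonnegative and summing to 1. -/
def IsPMF (P : (∀ i, 𝒳 i) → ℝ) : Prop :=
  (∀ x, 0 ≤ P x) ∧ ∑ x, P x = 1

open Classical in
/-- The marginal `P(x_S)`, obtained by summing out the coordinates outside `S`. -/
noncomputable def margin (P : (∀ i, 𝒳 i) → ℝ) (S : Finset (Fin p)) (x : ∀ i, 𝒳 i) : ℝ :=
  ∑ y : ∀ i, 𝒳 i, if ∀ i ∈ S, y i = x i then P y else 0

/-- `X_A` and `X_B` are conditionally independent given `X_C` under `P`:
for all `x`, `P(x_{A∪B∪C})·P(x_C) = P(x_{A∪C})·P(x_{B∪C})`. -/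
def CondIndep (P : (∀ i, 𝒳 i) → ℝ) (A B C : Finset (Fin p)) : Prop :=
  ∀ x, margin P (A ∪ B ∪ C) x * margin P C x = margin P (A ∪ C) x * margin P (B ∪ C) x

/-- `E` satisfies the global Markov property for `P` (`E` is an I-MAP of `P`):
d-separation implies conditional independence. -/
def IsIMAP (E : Fin p → Fin p → Prop) (P : (∀ i, 𝒳 i) → ℝ) : Prop :=
  ∀ i j (C : Finset (Fin p)), i ≠ j → i ∉ C → j ∉ C → DSep E i j C →
    CondIndep P {i} {j} C

/-- `P` factorizes according to `E`: there are nonnegative kernels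
`φ i`, each depending only on `x i` and the values of the parents of `i`,
normalized in `x i`, whose product is `P`. -/
def Factorizes (E : Fin p → Fin p → Prop) (P : (∀ i, 𝒳 i) → ℝ) : Prop :=
  ∃ φ : ∀ _ : Fin p, (∀ i, 𝒳 i) → ℝ,
    (∀ i x, 0 ≤ φ i x) ∧
    (∀ i x y, x i = y i → (∀ k, E k i → x k = y k) → φ i x = φ i y) ∧
    (∀ i x, ∑ a : 𝒳 i, φ i (Function.update x i a) = 1) ∧
    ∀ x, P x = ∏ i, φ i x

/-! ### Cheapest walks in a weighted transition system -/

section Cost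

variable {S : Type*} {step : ℕ → S → S → Prop} {tgt : S → Prop}

/-- A state satisfying `tgt` can be reached from `s` at total cost `n`. -/
inductive ReachAt (step : ℕ → S → S → Prop) (tgt : S → Prop) : ℕ → S → Prop
  | nil {s} : tgt s → ReachAt step tgt 0 s
  | cons {c n s s'} : step c s s' → ReachAt step tgt n s' → ReachAt step tgt (c + n) s

/-- A state satisfying `tgt` can be reached from `s`. -/
def CanReach (step : ℕ → S → S → Prop) (tgt : S → Prop) (s : S) : Prop :=
  ∃ n, ReachAt step tgt n s

/-- The least cost of reaching a state satisfying `tgt` (`0` if there is none). -/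
noncomputable def cost (step : ℕ → S → S → Prop) (tgt : S → Prop) (s : S) : ℕ :=
  sInf {n | ReachAt step tgt n s}

theorem CanReach.reachAt_cost {s : S} (h : CanReach step tgt s) :
    ReachAt step tgt (cost step tgt s) s :=
  Nat.sInf_mem h

theorem ReachAt.cost_le {n : ℕ} {s : S} (h : ReachAt step tgt n s) : cost step tgt s ≤ n :=
  Nat.sInf_le h

theorem CanReach.of_tgt {s : S} (h : tgt s) : CanReach step tgt s :=
  ⟨0, .nil h⟩

theorem cost_eq_zero {s : S} (h : tgt s) : cost step tgt s = 0 :=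
  Nat.le_zero.1 (ReachAt.nil h).cost_le

theorem CanReach.cons {c : ℕ} {s s' : S} (h : step c s s') (h' : CanReach step tgt s') :
    CanReach step tgt s :=
  ⟨_, .cons h h'.reachAt_cost⟩

theorem CanReach.cost_le {c : ℕ} {s s' : S} (h' : CanReach step tgt s') (h : step c s s') :
    cost step tgt s ≤ c + cost step tgt s' :=
  (ReachAt.cons h h'.reachAt_cost).cost_le

theorem CanReach.tgt_or_step {s : S} (h : CanReach step tgt s) :
    (tgt s ∧ cost step tgt s = 0) ∨ ∃ c s', step c s s' ∧ CanReach step tgt s' ∧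
      cost step tgt s = c + cost step tgt s' := by
  have key : ∀ n, ReachAt step tgt n s → n = cost step tgt s →
      (tgt s ∧ cost step tgt s = 0) ∨ ∃ c s', step c s s' ∧ CanReach step tgt s' ∧
        cost step tgt s = c + cost step tgt s' := by
    rintro n (ht | ⟨hs, hr⟩) hn
    · exact .inl ⟨ht, hn.symm⟩
    · refine .inr ⟨_, _, hs, ⟨_, hr⟩, ?_⟩
      have h1 := hr.cost_le
      have h2 := CanReach.cost_le ⟨_, hr⟩ hs
      omega
  exact key _ h.reachAt_cost rfl

theorem CanReach.exists_walk (hpos : ∀ c s s', step c s s' → 0 < c) {s : S}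
    (h : CanReach step tgt s) :
    ∃ (L : ℕ) (g : ℕ → S), g 0 = s ∧ tgt (g L) ∧ (∀ t ≤ L, CanReach step tgt (g t)) ∧
      ∀ t < L, ∃ c, step c (g t) (g (t + 1)) ∧
        cost step tgt (g t) = c + cost step tgt (g (t + 1)) := by
  induction hn : cost step tgt s using Nat.strong_induction_on generalizing s with
  | _ n ih =>
  rcases h.tgt_or_step with ⟨ht, -⟩ | ⟨c, s', hs, hr, hc⟩
  · exact ⟨0, fun _ => s, rfl, ht, fun _ _ => h, fun t ht => absurd ht (by omega)⟩
  · obtain ⟨L, g, h0, hL, hg, hstep⟩ := ih _ (by have := hpos _ _ _ hs; omega) hr rfl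
    refine ⟨L + 1, fun t => Nat.casesOn t s g, rfl, hL, ?_, ?_⟩
    · rintro (_ | t) ht
      · exact h
      · exact hg t (by omega)
    · rintro (_ | t) ht
      · exact ⟨c, by simpa [h0] using hs, by simpa [h0] using hc⟩
      · exact hstep t (by omega)

end Cost

/-! ### d-connecting walks -/

section Walks

variable {E : V → V → Prop} {C : Finset V} {i j : V}

theorem Acyclic.asymm (hE : Acyclic E) {u v : V} (h : E u v) (h' : E v u) : False :=
  hE u (.tail (.single h) h')

/-- Some vertex of `C` is a descendant of `v`. -/
abbrev ToSet (E : V → V → Prop) (C : Finset V) (v : V) : Prop :=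
  CanReach (fun c u w => c = 1 ∧ E u w) (· ∈ C) v

/-- The length of a shortest directed path from `v` to `C`. -/
noncomputable abbrev depth (E : V → V → Prop) (C : Finset V) (v : V) : ℕ :=
  cost (fun c u w => c = 1 ∧ E u w) (· ∈ C) v

theorem ToSet.of_desc {v d : V} (hd : d ∈ C) (h : Desc E v d) : ToSet E C v := by
  induction h using Relation.ReflTransGen.head_induction_on with
  | refl => exact .of_tgt hd
  | head h _ ih => exact .cons ⟨rfl, h⟩ ih

theorem ToSet.exists_desc {v : V} (h : ToSet E C v) : ∃ d ∈ C, Desc E v d := by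
  obtain ⟨n, hn⟩ := h
  induction hn with
  | nil h => exact ⟨_, h, .refl⟩
  | cons h _ ih =>
    obtain ⟨d, hd, hd'⟩ := ih
    exact ⟨d, hd, .head h.2 hd'⟩

/-- Transitions of a d-connecting walk given `C`. A state is a vertex together with a flag
telling whether the last edge of the walk points into it. Passing a collider `v` costs the
distance from `v` to `C` in addition to the cost `1` of each edge. -/
inductive BallStep (E : V → V → Prop) (C : Finset V) : ℕ → V × Bool → V × Bool → Prop
  | down {v w : V} {b : Bool} : v ∉ C → E v w → BallStep E C 1 (v, b) (w, true)
  | up {v w : V} : v ∉ C → E w v → BallStep E C 1 (v, false) (w, false)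
  | bounce {v w : V} : ToSet E C v → E w v → BallStep E C (1 + depth E C v) (v, true) (w, false)

/-- There is a d-connecting walk given `C` from the state `s` to the vertex `j`. -/
abbrev Conn (E : V → V → Prop) (C : Finset V) (j : V) (s : V × Bool) : Prop :=
  CanReach (BallStep E C) (fun s => s.1 = j) s

/-- The least cost of a d-connecting walk given `C` from the state `s` to the vertex `j`. -/
noncomputable abbrev connCost (E : V → V → Prop) (C : Finset V) (j : V) (s : V × Bool) : ℕ :=
  cost (BallStep E C) (fun s => s.1 = j) s

theorem BallStep.pos {c : ℕ} {s s' : V × Bool} (h : BallStep E C c s s') : 0 < c := by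
  cases h <;> omega

theorem Conn.notMem {v : V} (hj : j ∉ C) (h : Conn E C j (v, false)) : v ∉ C := by
  rcases h.tgt_or_step with ⟨rfl, -⟩ | ⟨c, s', hs, -, -⟩
  · exact hj
  · cases hs <;> assumption

theorem Conn.into {v : V} {b : Bool} (h : Conn E C j (v, b)) (hv : ToSet E C v) :
    Conn E C j (v, true) ∧ connCost E C j (v, true) ≤ depth E C v + connCost E C j (v, b) := by
  cases b with
  | true => exact ⟨h, by omega⟩
  | false =>
    rcases h.tgt_or_step with ⟨rfl, -⟩ | ⟨c, s', hs, hr, hc⟩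
    · exact ⟨.of_tgt rfl,
        (cost_eq_zero (tgt := fun s : V × Bool => s.1 = v) rfl).trans_le (Nat.zero_le _)⟩
    · cases hs with
      | down h1 h2 =>
        have := hr.cost_le (.down (b := true) h1 h2)
        exact ⟨.cons (.down h1 h2) hr, by simp only [connCost]; omega⟩
      | up h1 h2 =>
        have := hr.cost_le (.bounce hv h2)
        exact ⟨.cons (.bounce hv h2) hr, by simp only [connCost]; omega⟩

/-- `v` is the next vertex after `u` on a shortest directed path from `u` to `C`. -/
def Descent (E : V → V → Prop) (C : Finset V) (u v : V) : Prop :=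
  E u v ∧ ToSet E C v ∧ depth E C v + 1 = depth E C u

theorem Descent.notMem {u v : V} (h : Descent E C u v) : u ∉ C := by
  intro hu
  have h0 : depth E C u = 0 := cost_eq_zero hu
  have := h.2.2
  omega

theorem ToSet.mem_or_descent {v : V} (h : ToSet E C v) : v ∈ C ∨ ∃ w, Descent E C v w := by
  rcases h.tgt_or_step with ⟨hv, -⟩ | ⟨c, w, ⟨rfl, hs⟩, hr, hc⟩
  · exact .inl hv
  · exact .inr ⟨w, hs, hr, by simp only [depth]; omega⟩

theorem Conn.descend {u v : V} (h : Relation.ReflTransGen (Descent E C) u v)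
    (hv : Conn E C j (v, true)) :
    Conn E C j (u, true) ∧
      connCost E C j (u, true) + depth E C v ≤ depth E C u + connCost E C j (v, true) := by
  induction h using Relation.ReflTransGen.head_induction_on with
  | refl => exact ⟨hv, by omega⟩
  | @head a c h _ ih =>
    have h1 := ih.1.cost_le (.down (b := true) h.notMem h.1)
    have h2 := h.2.2
    have h3 := ih.2
    exact ⟨.cons (.down h.notMem h.1) ih.1, by simp only [connCost] at *; omega⟩

theorem Conn.ascend {u v : V} (h : Relation.ReflTransGen (Descent E C) u v)
    (hu : Conn E C j (u, false)) (hv : v ∉ C) :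
    Conn E C j (v, false) ∧
      connCost E C j (v, false) + depth E C v ≤ depth E C u + connCost E C j (u, false) := by
  induction h with
  | refl => exact ⟨hu, by omega⟩
  | @tail a c _ h ih =>
    have ih := ih h.notMem
    have h1 := ih.1.cost_le (.up hv h.1)
    have h2 := h.2.2
    have h3 := ih.2
    exact ⟨.cons (.up hv h.1) ih.1, by simp only [connCost] at *; omega⟩

/-- `g 0, …, g L` is a cheapest d-connecting walk from `i` to `j` given `C`. -/
structure OptWalk (E : V → V → Prop) (C : Finset V) (i j : V) (L : ℕ) (g : ℕ → V × Bool) :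
    Prop where
  start : g 0 = (i, false)
  fst_last : (g L).1 = j
  conn : ∀ t ≤ L, Conn E C j (g t)
  next : ∀ t < L, ∃ c, BallStep E C c (g t) (g (t + 1)) ∧
    connCost E C j (g t) = c + connCost E C j (g (t + 1))

theorem Conn.exists_optWalk (h : Conn E C j (i, false)) : ∃ L g, OptWalk E C i j L g := by
  obtain ⟨L, g, h0, hL, hg, hstep⟩ := h.exists_walk fun _ _ _ => BallStep.pos
  exact ⟨L, g, h0, hL, hg, hstep⟩

namespace OptWalk

variable {L : ℕ} {g : ℕ → V × Bool}

theorem connCost_antitone (W : OptWalk E C i j L g) {s t : ℕ} (hst : s ≤ t) (ht : t ≤ L) :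
    connCost E C j (g t) ≤ connCost E C j (g s) := by
  induction t, hst using Nat.le_induction with
  | base => exact le_rfl
  | succ t hst ih =>
    obtain ⟨c, -, hc⟩ := W.next t (by omega)
    have := ih (by omega)
    omega

theorem connCost_lt (W : OptWalk E C i j L g) {s t : ℕ} (hst : s < t) (ht : t ≤ L) :
    connCost E C j (g t) < connCost E C j (g s) := by
  obtain ⟨c, hs, hc⟩ := W.next s (by omega)
  have := W.connCost_antitone (s := s + 1) hst ht
  have := hs.pos
  omega

theorem depth_lt (W : OptWalk E C i j L g) (n s : ℕ) (hL : s + n ≤ L)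
    (hs : (g s).2 = true) (ht : (g (s + n)).2 = false) :
    ToSet E C (g s).1 ∧
      connCost E C j (g (s + n)) + depth E C (g s).1 + 1 ≤ connCost E C j (g s) := by
  induction n generalizing s with
  | zero => simp_all
  | succ n ih =>
    obtain ⟨c, hstep, hc⟩ := W.next s (by omega)
    have ih := ih (s + 1) (by omega)
    rw [show s + 1 + n = s + (n + 1) by omega] at ih
    have hanti := W.connCost_antitone (s := s + 1) (t := s + (n + 1)) (by omega) hL
    generalize g s = a at *
    generalize g (s + 1) = b at *
    cases hstep with
    | down h1 h2 =>
      obtain ⟨h3, h4⟩ := ih rfl ht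
      have h5 : depth E C _ ≤ 1 + depth E C _ := h3.cost_le ⟨rfl, h2⟩
      exact ⟨.cons ⟨rfl, h2⟩ h3, by simp only at *; omega⟩
    | up => simp at hs
    | bounce h1 h2 => exact ⟨h1, by simp only at *; omega⟩

theorem fst_ne (W : OptWalk E C i j L g) (hj : j ∉ C) {s t : ℕ} (hst : s < t) (ht : t ≤ L) :
    (g s).1 ≠ (g t).1 := by
  intro heq
  have hlt := W.connCost_lt hst ht
  have hconn := W.conn s (by omega)
  have hdepth := W.depth_lt (t - s) s (by omega)
  rw [show s + (t - s) = t by omega] at hdepth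
  rcases ht.eq_or_lt with rfl | ht'
  · have : connCost E C j (g s) = 0 := cost_eq_zero (heq.trans W.fst_last)
    omega
  obtain ⟨c, hstep, hc⟩ := W.next t ht'
  have hr := W.conn (t + 1) ht'
  generalize g s = a at *
  generalize g t = a' at *
  generalize g (t + 1) = a'' at *
  obtain ⟨v, b⟩ := a
  cases hstep with
  | down h1 h2 =>
    obtain rfl : v = _ := heq
    have := hr.cost_le (.down (b := b) h1 h2)
    simp only [connCost] at *
    omega
  | up h1 h2 =>
    obtain rfl : v = _ := heq
    cases b with
    | false => omega
    | true =>
      obtain ⟨h3, h4⟩ := hdepth rfl rfl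
      have := hr.cost_le (.bounce h3 h2)
      simp only [connCost] at *
      omega
  | bounce h1 h2 =>
    obtain rfl : v = _ := heq
    cases b with
    | true => omega
    | false =>
      have := hr.cost_le (.up (hconn.notMem hj) h2)
      simp only [connCost] at *
      omega

theorem fst_injective (W : OptWalk E C i j L g) (hj : j ∉ C) {s t : ℕ} (hs : s ≤ L) (ht : t ≤ L)
    (h : (g s).1 = (g t).1) : s = t := by
  rcases lt_trichotomy s t with hst | hst | hst
  · exact absurd h (W.fst_ne hj hst ht)
  · exact hst
  · exact absurd h.symm (W.fst_ne hj hst hs)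

theorem adj (W : OptWalk E C i j L g) {t : ℕ} (ht : t < L) : Adj E (g t).1 (g (t + 1)).1 := by
  obtain ⟨c, hstep, -⟩ := W.next t ht
  generalize g t = a at *
  generalize g (t + 1) = b at *
  cases hstep with
  | down _ h => exact .inl h
  | up _ h => exact .inr h
  | bounce _ h => exact .inr h

theorem edge_of_snd (W : OptWalk E C i j L g) {t : ℕ} (ht : t < L) (h : (g (t + 1)).2 = true) :
    E (g t).1 (g (t + 1)).1 := by
  obtain ⟨c, hstep, -⟩ := W.next t ht
  generalize g t = a at *
  generalize g (t + 1) = b at *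
  cases hstep <;> simp_all

theorem edge_of_not_snd (W : OptWalk E C i j L g) {t : ℕ} (ht : t < L)
    (h : (g (t + 1)).2 = false) : E (g (t + 1)).1 (g t).1 := by
  obtain ⟨c, hstep, -⟩ := W.next t ht
  generalize g t = a at *
  generalize g (t + 1) = b at *
  cases hstep <;> simp_all

theorem snd_eq_true (W : OptWalk E C i j L g) (hE : Acyclic E) {t : ℕ} (ht : t < L)
    (h : E (g t).1 (g (t + 1)).1) : (g (t + 1)).2 = true := by
  by_contra hb
  exact hE.asymm h (W.edge_of_not_snd ht (by simpa using hb))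

theorem snd_eq_false (W : OptWalk E C i j L g) (hE : Acyclic E) {t : ℕ} (ht : t < L)
    (h : E (g (t + 1)).1 (g t).1) : (g (t + 1)).2 = false := by
  by_contra hb
  exact hE.asymm h (W.edge_of_snd ht (by simpa using hb))

theorem colliderAt_iff (W : OptWalk E C i j L g) (hE : Acyclic E) {t : ℕ} (h0 : 0 < t)
    (ht : t < L) :
    ColliderAt E (fun t => (g t).1) t ↔ (g t).2 = true ∧ (g (t + 1)).2 = false := by
  obtain ⟨t, rfl⟩ : ∃ s, t = s + 1 := ⟨t - 1, by omega⟩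
  constructor
  · rintro ⟨h1, h2⟩
    exact ⟨W.snd_eq_true hE (by omega) h1, W.snd_eq_false hE ht h2⟩
  · rintro ⟨h1, h2⟩
    exact ⟨W.edge_of_snd (by omega) h1, W.edge_of_not_snd ht h2⟩

theorem bounce (W : OptWalk E C i j L g) {t : ℕ} (ht : t < L) (h1 : (g t).2 = true)
    (h2 : (g (t + 1)).2 = false) :
    ToSet E C (g t).1 ∧
      connCost E C j (g t) = 1 + depth E C (g t).1 + connCost E C j (g (t + 1)) := by
  obtain ⟨c, hstep, hc⟩ := W.next t ht
  generalize g t = a at *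
  generalize g (t + 1) = b at *
  cases hstep <;> simp_all

theorem notMem (W : OptWalk E C i j L g) {t : ℕ} (ht : t < L)
    (h : ¬ ((g t).2 = true ∧ (g (t + 1)).2 = false)) : (g t).1 ∉ C := by
  obtain ⟨c, hstep, -⟩ := W.next t ht
  generalize g t = a at *
  generalize g (t + 1) = b at *
  cases hstep <;> simp_all

theorem isPath (W : OptWalk E C i j L g) (hij : i ≠ j) (hj : j ∉ C) :
    IsPath E L (fun t => (g t).1) i j := by
  refine ⟨?_, by simp [W.start], W.fst_last, fun s t hs ht h => W.fst_injective hj hs ht h,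
    fun t ht => W.adj ht⟩
  rcases Nat.eq_zero_or_pos L with rfl | h
  · exact absurd (by simpa [W.start] using W.fst_last) hij
  · exact h

theorem dConn (W : OptWalk E C i j L g) (hE : Acyclic E) : DConn E L (fun t => (g t).1) C := by
  intro t h0 ht
  rw [W.colliderAt_iff hE h0 ht]
  refine ⟨fun h => .inr (W.bounce ht h.1 h.2).1.exists_desc, fun h => W.notMem ht h⟩

/-- A shortest directed path from a collider of a cheapest walk to `C` does not meet the walk
again. -/
theorem fst_ne_of_descent (W : OptWalk E C i j L g) (hE : Acyclic E) (hj : j ∉ C) {k t : ℕ}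
    (hk : k < L) (h1 : (g k).2 = true) (h2 : (g (k + 1)).2 = false) {v : V}
    (hv : Relation.TransGen (Descent E C) (g k).1 v) (ht : t ≤ L) : (g t).1 ≠ v := by
  intro heq
  obtain ⟨u, hu, huv⟩ := Relation.TransGen.tail'_iff.1 hv
  have hcost := (W.bounce hk h1 h2).2
  rcases lt_trichotomy t k with htk | rfl | htk
  · have hlt := W.connCost_lt htk hk.le
    obtain ⟨u₁, hu₁, -⟩ := Relation.TransGen.head'_iff.1 hv
    have hw : Conn E C j ((g (k + 1)).1, false) := by
      simpa [← h2] using W.conn (k + 1) hk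
    have hstep := BallStep.up hu₁.notMem (W.edge_of_not_snd hk h2)
    have hc : Conn E C j ((g k).1, false) := .cons hstep hw
    have hc' := hw.cost_le hstep
    have ⟨h3, h4⟩ := Conn.ascend hu hc huv.notMem
    have h5 := huv.2.2
    have h6 : connCost E C j (g (k + 1)) = connCost E C j ((g (k + 1)).1, false) := by
      rw [← h2]
    have hconn := W.conn t ht
    rcases hgt : g t with ⟨v', b⟩
    rw [hgt] at hlt heq hconn
    obtain rfl : v' = v := heq
    cases b with
    | true =>
      have := h3.cost_le (.bounce huv.2.1 huv.1)
      simp only [connCost] at *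
      omega
    | false =>
      have := h3.cost_le (.up (hconn.notMem hj) huv.1)
      simp only [connCost] at *
      omega
  · rw [← heq] at hv
    exact hE _ (hv.lift id fun _ _ h => h.1)
  · have hle := W.connCost_antitone (s := k + 1) htk ht
    have ⟨h3, h4⟩ := (show Conn E C j ((g t).1, (g t).2) from W.conn t ht).into (heq ▸ huv.2.1)
    rw [heq] at h3 h4
    have ⟨h5, h6⟩ := Conn.descend hv.to_reflTransGen h3
    have h7 : connCost E C j (g k) = connCost E C j ((g k).1, true) := by rw [← h1]
    have h8 : connCost E C j (v, (g t).2) = connCost E C j (g t) := by rw [← heq]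
    omega

end OptWalk

/-! ### d-separation in terms of walks -/

open Classical in
theorem Conn.of_dConn (hE : Acyclic E) {n : ℕ} {f : ℕ → V} (hi : i ∉ C) (hf : IsPath E n f i j)
    (hC : DConn E n f C) : Conn E C j (i, false) := by
  obtain ⟨hn, h0, hj, -, hadj⟩ := hf
  have key : ∀ m t, t + m = n → Conn E C j (f t, decide (0 < t ∧ E (f (t - 1)) (f t))) := by
    intro m
    induction m with
    | zero =>
      rintro t rfl
      exact .of_tgt hj
    | succ m ih =>
      intro t ht
      have ih := ih (t + 1) (by omega)
      simp only [Nat.add_sub_cancel, Nat.succ_pos, true_and] at ih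
      have hnot : ¬ (0 < t ∧ ColliderAt E f t) → f t ∉ C := by
        intro h
        rcases Nat.eq_zero_or_pos t with rfl | h0'
        · rwa [h0]
        · exact (hC t h0' (by omega)).2 fun h' => h ⟨h0', h'⟩
      rcases hadj t (by omega) with h | h
      · rw [decide_eq_true h] at ih
        exact .cons (.down (hnot fun h' => hE.asymm h h'.2.2) h) ih
      · rw [decide_eq_false fun h' => hE.asymm h h'] at ih
        by_cases hb : 0 < t ∧ E (f (t - 1)) (f t)
        · rw [decide_eq_true hb]
          refine .cons (.bounce ?_ h) ih
          rcases (hC t hb.1 (by omega)).1 ⟨hb.2, h⟩ with h' | ⟨d, hd, hd'⟩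
          · exact .of_tgt h'
          · exact .of_desc hd hd'
        · rw [decide_eq_false hb]
          exact .cons (.up (hnot fun h' => hb ⟨h'.1, h'.2.1⟩) h) ih
  simpa [h0] using key n 0 (by omega)

theorem dSep_iff_not_conn (hE : Acyclic E) (hij : i ≠ j) (hi : i ∉ C) (hj : j ∉ C) :
    DSep E i j C ↔ ¬ Conn E C j (i, false) := by
  constructor
  · intro h hc
    obtain ⟨L, g, W⟩ := hc.exists_optWalk
    exact h L _ (W.isPath hij hj) (W.dConn hE)
  · exact fun h n f hf hC => h (.of_dConn hE hi hf hC)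

/-- Local Markov property: a vertex is d-separated from a non-descendant given any set of
non-descendants containing its parents. -/
theorem dSep_of_not_desc (hE : Acyclic E) (hij : i ≠ j) (hj : j ∉ C)
    (hpa : ∀ u, E u i → u ∈ C) (hjd : ¬ Desc E i j) (hC : ∀ c ∈ C, ¬ Desc E i c) :
    DSep E i j C := by
  rw [dSep_iff_not_conn hE hij (fun h => hC i h .refl) hj]
  rintro ⟨n, hn⟩
  have key : ∀ n s, ReachAt (BallStep E C) (fun s => s.1 = j) n s →
      s = (i, false) ∨ (s.2 = true ∧ Desc E i s.1) ∨ (s.2 = false ∧ s.1 ∈ C) → False := by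
    intro n s h
    induction h with
    | nil h =>
      rintro (rfl | h' | h')
      · exact hij h
      · exact hjd (h ▸ h'.2)
      · exact hj (h ▸ h'.2)
    | cons h _ ih =>
      intro h'
      refine ih ?_
      cases h with
      | down h1 h2 =>
        refine .inr (.inl ⟨rfl, ?_⟩)
        rcases h' with h' | h' | h'
        · obtain rfl := (Prod.ext_iff.1 h').1
          exact .single h2
        · exact .tail h'.2 h2
        · exact absurd h'.2 h1
      | up h1 h2 =>
        refine .inr (.inr ⟨rfl, ?_⟩)
        rcases h' with h' | h' | h'
        · obtain rfl := (Prod.ext_iff.1 h').1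
          exact hpa _ h2
        · simp at h'
        · exact absurd h'.2 h1
      | bounce h1 h2 =>
        exfalso
        obtain ⟨d, hd, hd'⟩ := h1.exists_desc
        rcases h' with h' | h' | h'
        · simp at h'
        · exact hC d hd (h'.2.trans hd')
        · simp at h'
  exact key n _ hn (.inl rfl)

/-- Some d-connecting walk given `C` starting at `i` ends in the state `s`. -/
abbrev WalkTo (E : V → V → Prop) (C : Finset V) (i : V) (s : V × Bool) : Prop :=
  Relation.ReflTransGen (fun s s' => ∃ c, BallStep E C c s s') (i, false) s

theorem WalkTo.conn {b : Bool} (h : WalkTo E C i (j, b)) : Conn E C j (i, false) := by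
  have key : ∀ s, Relation.ReflTransGen (fun s s' => ∃ c, BallStep E C c s s') s (j, b) →
      Conn E C j s := by
    intro s h
    induction h using Relation.ReflTransGen.head_induction_on with
    | refl => exact .of_tgt rfl
    | head h _ ih => exact .cons h.choose_spec ih
  exact key _ h

theorem WalkTo.desc {v w : V} {b : Bool} (h : WalkTo E C i (v, b)) (hC : ¬ ToSet E C v)
    (hvw : Desc E v w) : ∃ b', WalkTo E C i (w, b') := by
  induction hvw with
  | refl => exact ⟨b, h⟩
  | @tail x y hvx hxy ih =>
    obtain ⟨b', hb'⟩ := ih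
    exact ⟨true, .tail hb' ⟨_, .down (fun hx => hC (.of_desc hx hvx)) hxy⟩⟩

theorem walkTo_of_desc {v : V} (hC : ¬ ToSet E C v) (hvi : Desc E v i) :
    WalkTo E C i (v, false) := by
  induction hvi using Relation.ReflTransGen.head_induction_on with
  | refl => exact .refl
  | head h _ ih =>
    have hc := fun h' => hC (.cons ⟨rfl, h⟩ h')
    exact .tail (ih hc) ⟨_, .up (fun h' => hc (.of_tgt h')) h⟩

theorem WalkTo.parent {w u : V} (hsep : ¬ Conn E C j (i, false))
    (hw : ∃ k, (k = i ∨ k = j ∨ k ∈ C) ∧ Desc E w k) (h : WalkTo E C i (w, true)) (huw : E u w) :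
    ∃ b, WalkTo E C i (u, b) := by
  by_cases hC : ToSet E C w
  · exact ⟨false, .tail h ⟨_, .bounce hC huw⟩⟩
  · obtain ⟨k, rfl | rfl | hk, hwk⟩ := hw
    · exact ⟨false, .tail (walkTo_of_desc hC hwk) ⟨_, .up (fun h' => hC (.of_tgt h')) huw⟩⟩
    · obtain ⟨b, hb⟩ := h.desc hC hwk
      exact absurd hb.conn hsep
    · exact absurd (.of_desc hk hwk) hC

/-- If `i` and `j` are d-separated given `C`, a family `{w} ∪ pa(w)` of an ancestor `w` of
`{i, j} ∪ C` does not contain, outside `C`, both vertices reachable and vertices not reachable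
from `i` by d-connecting walks. -/
theorem WalkTo.family {w u u' : V} (hsep : ¬ Conn E C j (i, false))
    (hw : ∃ k, (k = i ∨ k = j ∨ k ∈ C) ∧ Desc E w k) (hu : u = w ∨ E u w) (hu' : u' = w ∨ E u' w)
    (huC : u ∉ C) (h : ∃ b, WalkTo E C i (u, b)) : ∃ b, WalkTo E C i (u', b) := by
  obtain ⟨b, hb⟩ := h
  rcases hu with rfl | hu
  · rcases hu' with rfl | hu'
    · exact ⟨b, hb⟩
    · cases b with
      | true => exact hb.parent hsep hw hu'
      | false => exact ⟨false, .tail hb ⟨_, .up huC hu'⟩⟩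
  · have hd : WalkTo E C i (w, true) := .tail hb ⟨_, .down huC hu⟩
    rcases hu' with rfl | hu'
    · exact ⟨true, hd⟩
    · exact hd.parent hsep hw hu'

end Walks

/-! ### Marginals -/

section Margin

theorem sum_sum_update (F : (∀ i, 𝒳 i) → ℝ) (m : Fin p) :
    ∑ y, ∑ a, F (Function.update y m a) = Fintype.card (𝒳 m) * ∑ y, F y := by
  have hinv : Function.Involutive
      fun q : (∀ i, 𝒳 i) × 𝒳 m => (Function.update q.1 m q.2, q.1 m) := by
    rintro ⟨y, a⟩
    simp
  calc ∑ y, ∑ a, F (Function.update y m a)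
      = ∑ q : (∀ i, 𝒳 i) × 𝒳 m, F (Function.update q.1 m q.2) :=
        (Fintype.sum_prod_type' fun (y : ∀ i, 𝒳 i) (a : 𝒳 m) => F (Function.update y m a)).symm
    _ = ∑ q : (∀ i, 𝒳 i) × 𝒳 m, F q.1 :=
        Fintype.sum_bijective _ hinv.bijective _ (fun q => F q.1) fun _ => rfl
    _ = Fintype.card (𝒳 m) * ∑ y, F y := by
        rw [Fintype.sum_prod_type' fun (y : ∀ i, 𝒳 i) (_ : 𝒳 m) => F y, Finset.mul_sum]
        simp only [Finset.sum_const, Finset.card_univ, nsmul_eq_mul]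

variable {P : (∀ i, 𝒳 i) → ℝ}

theorem margin_nonneg (hP : ∀ x, 0 ≤ P x) (S : Finset (Fin p)) (x : ∀ i, 𝒳 i) :
    0 ≤ margin P S x :=
  Finset.sum_nonneg fun y _ => by split_ifs <;> simp [hP]

theorem margin_anti (hP : ∀ x, 0 ≤ P x) {S T : Finset (Fin p)} (h : S ⊆ T) (x : ∀ i, 𝒳 i) :
    margin P T x ≤ margin P S x := by
  refine Finset.sum_le_sum fun y _ => ?_
  split_ifs with h1 h2
  · exact le_rfl
  · exact absurd (fun i hi => h1 i (h hi)) h2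
  · exact hP y
  · exact le_rfl

theorem margin_eq_zero_of_subset (hP : ∀ x, 0 ≤ P x) {S T : Finset (Fin p)} (h : S ⊆ T)
    {x : ∀ i, 𝒳 i} (hS : margin P S x = 0) : margin P T x = 0 :=
  le_antisymm (hS ▸ margin_anti hP h x) (margin_nonneg hP T x)

theorem margin_pos (hP : ∀ x, 0 ≤ P x) {S : Finset (Fin p)} {x y : ∀ i, 𝒳 i} (hy : 0 < P y)
    (hxy : ∀ i ∈ S, y i = x i) : 0 < margin P S x :=
  Finset.sum_pos' (fun z _ => by split_ifs <;> simp [hP]) ⟨y, Finset.mem_univ y, by rwa [if_pos hxy]⟩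

theorem margin_congr (S : Finset (Fin p)) {x x' : ∀ i, 𝒳 i} (h : ∀ i ∈ S, x i = x' i) :
    margin P S x = margin P S x' := by
  refine Finset.sum_congr rfl fun y _ => ?_
  congr 1
  exact propext (forall₂_congr fun i hi => by rw [h i hi])

theorem margin_univ (x : ∀ i, 𝒳 i) : margin P Finset.univ x = P x := by
  classical
  rw [margin, Finset.sum_eq_single x]
  · simp
  · intro y _ hy
    rw [if_neg]
    exact fun h => hy (funext fun i => h i (Finset.mem_univ i))
  · simp

theorem margin_empty (x : ∀ i, 𝒳 i) : margin P ∅ x = ∑ y, P y := by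
  simp [margin]

theorem sum_margin_insert_update {S : Finset (Fin p)} {m : Fin p} (hm : m ∉ S) (x : ∀ i, 𝒳 i) :
    ∑ a, margin P (insert m S) (Function.update x m a) = margin P S x := by
  classical
  simp only [margin]
  rw [Finset.sum_comm]
  refine Finset.sum_congr rfl fun y _ => ?_
  have : ∀ a, (∀ i ∈ insert m S, y i = Function.update x m a i) ↔
      (y m = a ∧ ∀ i ∈ S, y i = x i) := by
    intro a
    rw [Finset.forall_mem_insert, Function.update_self]
    refine and_congr_right fun _ => forall₂_congr fun i hi => ?_
    rw [Function.update_of_ne (by rintro rfl; exact hm hi)]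
  simp only [this, ite_and, Finset.sum_ite_eq, Finset.mem_univ, if_true]

/-- A normalized kernel at `m` may be replaced by the uniform kernel when nothing else depends on
the coordinate `m`. -/
theorem margin_kernel_mul {m : Fin p} {φ R : (∀ i, 𝒳 i) → ℝ}
    (hφ : ∀ y, ∑ a, φ (Function.update y m a) = 1)
    (hR : ∀ y a, R (Function.update y m a) = R y) {T : Finset (Fin p)} (hm : m ∉ T)
    (x : ∀ i, 𝒳 i) :
    margin (fun y => φ y * R y) T x =
      margin (fun y => (Fintype.card (𝒳 m) : ℝ)⁻¹ * R y) T x := by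
  classical
  have hc : (Fintype.card (𝒳 m) : ℝ) ≠ 0 := by
    have : Nonempty (𝒳 m) := ⟨x m⟩
    exact_mod_cast Fintype.card_ne_zero
  have hT : ∀ (y : ∀ i, 𝒳 i) a,
      (∀ i ∈ T, Function.update y m a i = x i) ↔ ∀ i ∈ T, y i = x i := fun y a =>
    forall₂_congr fun i hi => by rw [Function.update_of_ne (by rintro rfl; exact hm hi)]
  refine mul_left_cancel₀ hc ?_
  simp only [margin]
  rw [← sum_sum_update, Finset.mul_sum]
  refine Finset.sum_congr rfl fun y _ => ?_
  simp only [hT, hR]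
  split_ifs
  · rw [← Finset.sum_mul, hφ, mul_inv_cancel_left₀ hc, one_mul]
  · simp

/-- If a function is a product of a function of the coordinates in `S ∪ C` and a function of the
coordinates outside `S`, then coordinates in `S` are independent of those outside `S ∪ C`
given `C`. -/
theorem condIndep_mul {S : Fin p → Prop} {C : Finset (Fin p)} {F H : (∀ i, 𝒳 i) → ℝ}
    (hSC : ∀ c ∈ C, ¬ S c) (hF : ∀ y z, (∀ k, S k ∨ k ∈ C → y k = z k) → F y = F z)
    (hH : ∀ y z, (∀ k, ¬ S k → y k = z k) → H y = H z) {A B : Finset (Fin p)}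
    (hA : ∀ i ∈ A, S i) (hB : ∀ j ∈ B, ¬ S j) :
    CondIndep (fun y => F y * H y) A B C := by
  classical
  intro x
  have hinv : Function.Involutive fun q : (∀ i, 𝒳 i) × (∀ i, 𝒳 i) =>
      ((fun k => if S k then q.1 k else q.2 k : ∀ i, 𝒳 i),
        (fun k => if S k then q.2 k else q.1 k : ∀ i, 𝒳 i)) := by
    rintro ⟨y, z⟩
    ext k <;> by_cases hk : S k <;> simp [hk]
  simp only [margin]
  rw [Finset.sum_mul_sum, Finset.sum_mul_sum, ← Fintype.sum_prod_type',
    ← Fintype.sum_prod_type']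
  refine Fintype.sum_equiv hinv.toPerm _ _ ?_
  rintro ⟨y, z⟩
  simp only [Function.Involutive.coe_toPerm, ite_zero_mul_ite_zero]
  have hiff : ((∀ i ∈ A ∪ B ∪ C, y i = x i) ∧ ∀ i ∈ C, z i = x i) ↔
      (∀ i ∈ A ∪ C, (if S i then y i else z i) = x i) ∧
        ∀ i ∈ B ∪ C, (if S i then z i else y i) = x i := by
    simp only [Finset.mem_union]
    constructor
    · rintro ⟨h1, h2⟩
      refine ⟨?_, ?_⟩
      · rintro i (hi | hi)
        · rw [if_pos (hA i hi)]
          exact h1 i (.inl (.inl hi))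
        · rw [if_neg (hSC i hi)]
          exact h2 i hi
      · rintro i (hi | hi)
        · rw [if_neg (hB i hi)]
          exact h1 i (.inl (.inr hi))
        · rw [if_neg (hSC i hi)]
          exact h1 i (.inr hi)
    · rintro ⟨h1, h2⟩
      refine ⟨?_, fun i hi => ?_⟩
      · rintro i ((hi | hi) | hi)
        · simpa [hA i hi] using h1 i (.inl hi)
        · simpa [hB i hi] using h2 i (.inl hi)
        · simpa [hSC i hi] using h2 i (.inr hi)
      · simpa [hSC i hi] using h1 i (.inr hi)
  rw [if_congr hiff rfl rfl]
  refine if_ctx_congr Iff.rfl (fun h => ?_) fun _ => rfl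
  obtain ⟨h1, h2⟩ := hiff.2 h
  have e1 : F (fun k => if S k then y k else z k) = F y := hF _ _ fun k hk => by
    by_cases hS : S k
    · simp [hS]
    · have hkC := hk.resolve_left hS
      simp [hS, h1 k (by simp [hkC]), h2 k hkC]
  have e2 : F (fun k => if S k then z k else y k) = F z := hF _ _ fun k hk => by
    by_cases hS : S k
    · simp [hS]
    · have hkC := hk.resolve_left hS
      simp [hS, h1 k (by simp [hkC]), h2 k hkC]
  have e3 : H (fun k => if S k then y k else z k) = H z := hH _ _ fun k hk => by simp [hk]
  have e4 : H (fun k => if S k then z k else y k) = H y := hH _ _ fun k hk => by simp [hk]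
  rw [e1, e2, e3, e4]
  ring

end Margin

/-! ### The global Markov property -/

section Markov

variable {E : Fin p → Fin p → Prop}

theorem Acyclic.exists_source (hE : Acyclic E) {M : Finset (Fin p)} (hM : M.Nonempty) :
    ∃ m ∈ M, ∀ k ∈ M, ¬ E k m := by
  have : IsTrans (Fin p) (Relation.TransGen E) := ⟨fun _ _ _ => Relation.TransGen.trans⟩
  have : Std.Irrefl (Relation.TransGen E) := ⟨hE⟩
  have hwf := Finite.wellFounded_of_trans_of_irrefl (Relation.TransGen E)
  obtain ⟨m, hm, h⟩ := hwf.has_min (M : Set (Fin p)) hM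
  exact ⟨m, hm, fun k hk hkm => h k hk (.single hkm)⟩

theorem Acyclic.exists_sink (hE : Acyclic E) {M : Finset (Fin p)} (hM : M.Nonempty) :
    ∃ m ∈ M, ∀ k ∈ M, ¬ E m k :=
  Acyclic.exists_source (E := Function.swap E)
    (fun v h => hE v (Relation.transGen_swap.1 h)) hM

variable {φ : Fin p → (∀ i, 𝒳 i) → ℝ}

open Classical in
/-- The kernels of a set of vertices closed under children may be replaced by uniform kernels
without changing the marginals on the other vertices. -/
theorem margin_prod_kernels (hE : Acyclic E)
    (hloc : ∀ i x y, x i = y i → (∀ k, E k i → x k = y k) → φ i x = φ i y)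
    (hnorm : ∀ i x, ∑ a : 𝒳 i, φ i (Function.update x i a) = 1) (M : Finset (Fin p))
    (hM : ∀ w ∈ M, ∀ u, E w u → u ∈ M) {T : Finset (Fin p)} (hT : ∀ t ∈ T, t ∉ M)
    (x : ∀ i, 𝒳 i) :
    margin (fun y => ∏ w, φ w y) T x =
      margin (fun y => ∏ w, if w ∈ M then (Fintype.card (𝒳 w) : ℝ)⁻¹ else φ w y) T x := by
  induction M using Finset.strongInduction with
  | H M ih =>
  rcases M.eq_empty_or_nonempty with rfl | hne
  · simp
  obtain ⟨m, hm, hsrc⟩ := hE.exists_source hne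
  rw [ih (M.erase m) (Finset.erase_ssubset hm)
    (fun w hw u hwu => Finset.mem_erase.2 ⟨by
      rintro rfl
      exact hsrc w (Finset.mem_of_mem_erase hw) hwu, hM w (Finset.mem_of_mem_erase hw) u hwu⟩)
    (fun t ht h => hT t ht (Finset.mem_of_mem_erase h))]
  set R : (∀ i, 𝒳 i) → ℝ := fun y =>
    ∏ w ∈ Finset.univ.erase m, if w ∈ M then (Fintype.card (𝒳 w) : ℝ)⁻¹ else φ w y with hR
  have h1 : (fun y => ∏ w, if w ∈ M.erase m then (Fintype.card (𝒳 w) : ℝ)⁻¹ else φ w y) =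
      fun y => φ m y * R y := by
    funext y
    rw [← Finset.mul_prod_erase _ _ (Finset.mem_univ m), if_neg (Finset.notMem_erase m M)]
    congr 1
    refine Finset.prod_congr rfl fun w hw => ?_
    simp [Finset.ne_of_mem_erase hw]
  have h2 : (fun y => ∏ w, if w ∈ M then (Fintype.card (𝒳 w) : ℝ)⁻¹ else φ w y) =
      fun y => (Fintype.card (𝒳 m) : ℝ)⁻¹ * R y := by
    funext y
    rw [← Finset.mul_prod_erase _ _ (Finset.mem_univ m), if_pos hm]
  rw [h1, h2]
  refine margin_kernel_mul (hnorm m) (fun y a => ?_) (fun h => hT m h hm) x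
  refine Finset.prod_congr rfl fun w hw => ?_
  split_ifs with hwM
  · rfl
  · refine hloc w _ _ (Function.update_of_ne (Finset.ne_of_mem_erase hw) _ _) fun k hk => ?_
    refine Function.update_of_ne ?_ _ _
    rintro rfl
    exact hwM (hM _ hm _ hk)

theorem sum_prod_kernels (hE : Acyclic E) [∀ i, Nonempty (𝒳 i)]
    (hloc : ∀ i x y, x i = y i → (∀ k, E k i → x k = y k) → φ i x = φ i y)
    (hnorm : ∀ i x, ∑ a : 𝒳 i, φ i (Function.update x i a) = 1) :
    ∑ y, ∏ w, φ w y = 1 := by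
  classical
  have h := margin_prod_kernels hE hloc hnorm Finset.univ (fun _ _ _ _ => Finset.mem_univ _)
    (T := ∅) (by simp) (fun _ => Classical.arbitrary _)
  rw [margin_empty, margin_empty] at h
  rw [h]
  simp only [Finset.mem_univ, if_true, Finset.sum_const, Finset.card_univ, Fintype.card_pi,
    nsmul_eq_mul, Nat.cast_prod, ← Finset.prod_mul_distrib]
  exact Finset.prod_eq_one fun w _ =>
    mul_inv_cancel₀ (by exact_mod_cast Fintype.card_ne_zero)

theorem Factorizes.isIMAP (hE : Acyclic E) {P : (∀ i, 𝒳 i) → ℝ} (hP : Factorizes E P) :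
    IsIMAP E P := by
  classical
  intro i j C hij hi hj hsep
  rw [dSep_iff_not_conn hE hij hi hj] at hsep
  obtain ⟨φ, -, hloc, hnorm, hprod⟩ := hP
  obtain rfl : P = fun y => ∏ w, φ w y := funext hprod
  set A : Fin p → Prop := fun w => ∃ k, (k = i ∨ k = j ∨ k ∈ C) ∧ Desc E w k with hA
  set S : Fin p → Prop := fun u => u ∉ C ∧ ∃ b, WalkTo E C i (u, b) with hS
  set M : Finset (Fin p) := Finset.univ.filter fun w => ¬ A w with hM
  set ψ : Fin p → (∀ i, 𝒳 i) → ℝ := fun w y =>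
    if w ∈ M then (Fintype.card (𝒳 w) : ℝ)⁻¹ else φ w y with hψ
  set N : Fin p → Prop := fun w => A w ∧ ∃ u, (u = w ∨ E u w) ∧ S u with hN
  have hmargin : ∀ T : Finset (Fin p), (∀ t ∈ T, t = i ∨ t = j ∨ t ∈ C) → ∀ x,
      margin (fun y => ∏ w, φ w y) T x = margin (fun y => (∏ w with N w, ψ w y) *
        ∏ w with ¬ N w, ψ w y) T x := by
    intro T hT x
    rw [margin_prod_kernels hE hloc hnorm M]
    · congr 1
      funext y
      exact (Finset.prod_filter_mul_prod_filter_not _ _ _).symm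
    · intro w hw u hwu
      simp only [hM, Finset.mem_filter, Finset.mem_univ, true_and] at hw ⊢
      rintro ⟨k, hk, huk⟩
      exact hw ⟨k, hk, .head hwu huk⟩
    · intro t ht h
      simp only [hM, Finset.mem_filter, Finset.mem_univ, true_and] at h
      exact h ⟨t, hT t ht, .refl⟩
  have hCI : CondIndep (fun y => (∏ w with N w, ψ w y) * ∏ w with ¬ N w, ψ w y)
      ({i} : Finset (Fin p)) {j} C := by
    refine condIndep_mul (S := S) (fun c hc h => h.1 hc) ?_ ?_ ?_ ?_
    · intro y z hyz
      refine Finset.prod_congr rfl fun w hw => ?_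
      obtain ⟨hAw, u, hu, huS⟩ := (Finset.mem_filter.1 hw).2
      have hfam : ∀ k, k = w ∨ E k w → y k = z k := fun k hk => hyz k <| by
        by_cases hkC : k ∈ C
        · exact .inr hkC
        · exact .inl ⟨hkC, WalkTo.family hsep hAw hu hk huS.1 huS.2⟩
      simp only [hψ]
      rw [hloc w y z (hfam w (.inl rfl)) fun k hk => hfam k (.inr hk)]
    · intro y z hyz
      refine Finset.prod_congr rfl fun w hw => ?_
      have hw := (Finset.mem_filter.1 hw).2
      simp only [hψ]
      split_ifs with hwM
      · rfl
      · have hAw : A w := by simpa [hM] using hwM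
        have hfam : ∀ k, k = w ∨ E k w → y k = z k := fun k hk =>
          hyz k fun hkS => hw ⟨hAw, k, hk, hkS⟩
        exact hloc w y z (hfam w (.inl rfl)) fun k hk => hfam k (.inr hk)
    · intro k hk
      obtain rfl := Finset.mem_singleton.1 hk
      exact ⟨hi, false, .refl⟩
    · intro k hk
      obtain rfl := Finset.mem_singleton.1 hk
      exact fun h => hsep h.2.choose_spec.conn
  intro x
  rw [hmargin, hmargin, hmargin, hmargin]
  · exact hCI x
  all_goals
    intro t ht
    try simp only [Finset.mem_union, Finset.mem_singleton] at ht
    tauto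

theorem IsIMAP.margin_mul_margin (hE : Acyclic E) {P : (∀ i, 𝒳 i) → ℝ} (hP : ∀ x, 0 ≤ P x)
    (h : IsIMAP E P) {m : Fin p} {S : Finset (Fin p)} (hS : ∀ k, k ∈ S ↔ E k m)
    (R : Finset (Fin p)) (hR : ∀ r ∈ R, ¬ Desc E m r) (x : ∀ i, 𝒳 i) :
    margin P (insert m (S ∪ R)) x * margin P S x =
      margin P (insert m S) x * margin P (S ∪ R) x := by
  classical
  induction R using Finset.induction_on with
  | empty => simp
  | insert r R _ ih =>
    have ih := ih fun k hk => hR k (Finset.mem_insert_of_mem hk)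
    rw [Finset.union_insert]
    by_cases hrS : r ∈ S ∪ R
    · rwa [Finset.insert_eq_of_mem hrS]
    have hnd : ∀ k ∈ S ∪ R, ¬ Desc E m k := by
      intro k hk hmk
      rcases Finset.mem_union.1 hk with hk | hk
      · exact hE m (Relation.TransGen.tail' hmk ((hS k).1 hk))
      · exact hR k (Finset.mem_insert_of_mem hk) hmk
    have hr := hR r (Finset.mem_insert_self r R)
    have hmr : m ≠ r := by
      rintro rfl
      exact hr .refl
    have hCI := h m r (S ∪ R) hmr (fun hm => hnd m hm .refl) hrS
      (dSep_of_not_desc hE hmr hrS (fun u hu => Finset.mem_union_left _ ((hS u).2 hu)) hr hnd) x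
    have hunion : {m} ∪ {r} ∪ (S ∪ R) = insert m (insert r (S ∪ R)) := by
      ext k
      simp
    rw [hunion, Finset.singleton_union, Finset.singleton_union] at hCI
    by_cases h0 : margin P (S ∪ R) x = 0
    · have h1 : margin P (insert r (S ∪ R)) x = 0 :=
        margin_eq_zero_of_subset hP (Finset.subset_insert _ _) h0
      have h2 : margin P (insert m (insert r (S ∪ R))) x = 0 :=
        margin_eq_zero_of_subset hP (Finset.subset_insert _ _) h1
      rw [h1, h2, zero_mul, mul_zero]
    · refine mul_right_cancel₀ h0 ?_
      linear_combination margin P S x * hCI + margin P (insert r (S ∪ R)) x * ih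

theorem IsIMAP.factorizes (hE : Acyclic E) {P : (∀ i, 𝒳 i) → ℝ} (hP : IsPMF P)
    (h : IsIMAP E P) : Factorizes E P := by
  classical
  set pa : Fin p → Finset (Fin p) := fun m => Finset.univ.filter (E · m) with hpa
  have hmem : ∀ m k, k ∈ pa m ↔ E k m := fun m k => by simp [hpa]
  have hself : ∀ m, m ∉ pa m := fun m hm => hE m (.single ((hmem m m).1 hm))
  set φ : Fin p → (∀ i, 𝒳 i) → ℝ := fun m x =>
    if margin P (pa m) x = 0 then (Fintype.card (𝒳 m) : ℝ)⁻¹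
    else margin P (insert m (pa m)) x / margin P (pa m) x with hφ
  refine ⟨φ, ?_, ?_, ?_, ?_⟩
  · intro m x
    simp only [hφ]
    split_ifs
    · positivity
    · exact div_nonneg (margin_nonneg hP.1 _ _) (margin_nonneg hP.1 _ _)
  · intro m x y hm hxy
    have h1 : margin P (pa m) x = margin P (pa m) y :=
      margin_congr _ fun k hk => hxy k ((hmem m k).1 hk)
    have h2 : margin P (insert m (pa m)) x = margin P (insert m (pa m)) y :=
      margin_congr _ <| Finset.forall_mem_insert _ _ _ |>.2
        ⟨hm, fun k hk => hxy k ((hmem m k).1 hk)⟩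
    simp only [hφ, h1, h2]
  · intro m x
    have h1 : ∀ a, margin P (pa m) (Function.update x m a) = margin P (pa m) x := fun a =>
      margin_congr _ fun k hk => Function.update_of_ne (by rintro rfl; exact hself _ hk) _ _
    simp only [hφ, h1]
    split_ifs with h0
    · have : Nonempty (𝒳 m) := ⟨x m⟩
      simp
    · rw [← Finset.sum_div, sum_margin_insert_update (hself m), div_self h0]
  · intro x
    have key : ∀ M : Finset (Fin p), (∀ m ∈ M, ∀ k, E k m → k ∈ M) →
        margin P M x = ∏ m ∈ M, φ m x := by
      intro M
      induction M using Finset.strongInduction with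
      | H M ih =>
      intro hM
      rcases M.eq_empty_or_nonempty with rfl | hne
      · rw [margin_empty, hP.2, Finset.prod_empty]
      obtain ⟨m, hm, hsink⟩ := hE.exists_sink hne
      have hM' : ∀ l ∈ M.erase m, ∀ k, E k l → k ∈ M.erase m := fun l hl k hkl =>
        Finset.mem_erase.2 ⟨by
          rintro rfl
          exact hsink l (Finset.mem_of_mem_erase hl) hkl, hM l (Finset.mem_of_mem_erase hl) k hkl⟩
      have hdesc : ∀ v, Desc E m v → v ∈ M.erase m → False := by
        intro v hv
        induction hv with
        | refl => exact Finset.notMem_erase m M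
        | tail _ hbc ih => exact fun hc => ih (hM' _ hc _ hbc)
      have hsub : pa m ⊆ M.erase m := fun k hk => by
        have hkm := (hmem m k).1 hk
        exact Finset.mem_erase.2 ⟨by rintro rfl; exact hself _ hk, hM m hm k hkm⟩
      have hchain := h.margin_mul_margin hE hP.1 (hmem m) (M.erase m)
        (fun r hr hd => hdesc r hd hr) x
      rw [Finset.union_eq_right.2 hsub, Finset.insert_erase hm] at hchain
      rw [← Finset.mul_prod_erase _ _ hm, ← ih _ (Finset.erase_ssubset hm) hM']
      simp only [hφ]
      split_ifs with h0
      · rw [margin_eq_zero_of_subset hP.1 hsub h0,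
          margin_eq_zero_of_subset hP.1 (hsub.trans (Finset.erase_subset _ _)) h0, mul_zero]
      · rw [div_mul_eq_mul_div, eq_div_iff h0, hchain]
    rw [← key Finset.univ fun _ _ _ _ => Finset.mem_univ _, margin_univ]

end Markov

/-! ### Completeness of d-separation -/

section Completeness

variable {E : Fin p → Fin p → Prop}

/-- Satisfiable local constraints on the binary codes of the coordinates are the support of some
distribution factorizing according to the graph. -/
theorem exists_factorizes_of_constraints (hE : Acyclic E) (d : ∀ i, 𝒳 i → Bool)
    (hd : ∀ i, Function.Surjective (d i)) (allowed : Fin p → (Fin p → Bool) → Prop)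
    (hloc : ∀ v a b, a v = b v → (∀ k, E k v → a k = b k) → (allowed v a ↔ allowed v b))
    (hex : ∀ v a, ∃ b, allowed v (Function.update a v b)) :
    ∃ P : (∀ i, 𝒳 i) → ℝ, IsPMF P ∧ Factorizes E P ∧
      ∀ y, 0 < P y ↔ ∀ v, allowed v fun k => d k (y k) := by
  classical
  have : ∀ i, Nonempty (𝒳 i) := fun i => ⟨(hd i true).choose⟩
  set c : Fin p → (∀ i, 𝒳 i) → ℕ := fun v y =>
    (Finset.univ.filter fun a => allowed v fun k => d k (Function.update y v a k)).card with hc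
  set φ : Fin p → (∀ i, 𝒳 i) → ℝ := fun v y =>
    (if allowed v fun k => d k (y k) then 1 else 0) / (c v y : ℝ) with hφ
  have hcpos : ∀ v y, 0 < c v y := by
    intro v y
    obtain ⟨b, hb⟩ := hex v fun k => d k (y k)
    obtain ⟨a, rfl⟩ := hd v b
    refine Finset.card_pos.2 ⟨a, Finset.mem_filter.2 ⟨Finset.mem_univ a, ?_⟩⟩
    convert hb using 1
    funext k
    by_cases hk : k = v
    · subst hk
      simp
    · simp [hk]
  have hnonneg : ∀ v y, 0 ≤ φ v y := fun v y => by
    simp only [hφ]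
    positivity
  have hφloc : ∀ i x y, x i = y i → (∀ k, E k i → x k = y k) → φ i x = φ i y := by
    intro v x y hv hxy
    have h1 : (allowed v fun k => d k (x k)) ↔ allowed v fun k => d k (y k) :=
      hloc v _ _ (by rw [hv]) fun k hk => by rw [hxy k hk]
    have h2 : c v x = c v y := by
      simp only [hc]
      congr 1
      refine Finset.filter_congr fun a _ => hloc v _ _ (by simp) fun k hk => ?_
      by_cases hkv : k = v
      · subst hkv
        simp
      · simp [hkv, hxy k hk]
    simp only [hφ, h1, h2]
  have hnorm : ∀ i x, ∑ a : 𝒳 i, φ i (Function.update x i a) = 1 := by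
    intro v x
    simp only [hφ, hc, Function.update_idem]
    rw [← Finset.sum_div, Finset.sum_boole]
    exact div_self (by exact_mod_cast (hcpos v x).ne')
  refine ⟨fun y => ∏ v, φ v y, ⟨fun y => Finset.prod_nonneg fun v _ => hnonneg v y,
    sum_prod_kernels hE hφloc hnorm⟩, ⟨φ, hnonneg, hφloc, hnorm, fun _ => rfl⟩, fun y => ?_⟩
  constructor
  · intro h v
    by_contra hv
    refine h.ne' (Finset.prod_eq_zero (Finset.mem_univ v) ?_)
    simp [hφ, hv]
  · intro h
    refine Finset.prod_pos fun v _ => ?_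
    simp only [hφ, if_pos (h v)]
    exact one_div_pos.2 (by exact_mod_cast hcpos v y)

theorem exists_not_condIndep_of_constraints (hE : Acyclic E) (hcard : ∀ i, 2 ≤ Fintype.card (𝒳 i))
    {i j : Fin p} {C : Finset (Fin p)} (hij : i ≠ j) (hj : j ∉ C)
    (allowed : Fin p → (Fin p → Bool) → Prop)
    (hloc : ∀ v a b, a v = b v → (∀ k, E k v → a k = b k) → (allowed v a ↔ allowed v b))
    (hex : ∀ v a, ∃ b, allowed v (Function.update a v b))
    (hzero : ∀ v, allowed v fun _ => false)
    (hone : ∃ a : Fin p → Bool, (∀ v, allowed v a) ∧ a i = true ∧ ∀ k ∈ C, a k = false)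
    (hnot : ∀ a : Fin p → Bool, (∀ v, allowed v a) → a i = true → (∀ k ∈ C, a k = false) →
      a j = true) :
    ∃ P : (∀ i, 𝒳 i) → ℝ, IsPMF P ∧ Factorizes E P ∧ ¬ CondIndep P {i} {j} C := by
  classical
  have hd : ∀ i, ∃ d : 𝒳 i → Bool, Function.Surjective d := by
    intro i
    obtain ⟨u, v, huv⟩ := Fintype.exists_pair_of_one_lt_card (hcard i)
    exact ⟨fun x => decide (x = u), fun b => by
      cases b
      · exact ⟨v, by simpa using huv.symm⟩
      · exact ⟨u, by simp⟩⟩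
  choose d hd using hd
  choose e he using fun i => hd i
  obtain ⟨P, hP, hfac, hsupp⟩ := exists_factorizes_of_constraints hE d hd allowed hloc hex
  obtain ⟨a, ha, hai, haC⟩ := hone
  refine ⟨P, hP, hfac, fun hCI => ?_⟩
  set x : ∀ k, 𝒳 k := fun k => e k (if k = i then true else false) with hx
  have hxC : ∀ k ∈ C, k ≠ i → x k = e k false := fun k _ hk => by simp [hx, hk]
  have hiC : i ∉ C := fun h => by simp [haC i h] at hai
  have h0 : margin P ({i} ∪ {j} ∪ C) x = 0 := by
    refine Finset.sum_eq_zero fun y _ => ?_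
    split_ifs with hy
    · by_contra hne
      have hpos := (hsupp y).1 ((hP.1 y).lt_of_ne' hne)
      have := hnot _ hpos (by simp [hy i (by simp), hx, he])
        fun k hk => by
          have hki : k ≠ i := fun h => hiC (h ▸ hk)
          simp [hy k (by simp [hk]), hx, he, hki]
      simp [hy j (by simp), hx, he, hij.symm] at this
    · rfl
  have h1 : 0 < margin P ({i} ∪ C) x := by
    refine margin_pos hP.1 (y := fun k => e k (a k)) ((hsupp _).2 fun v => ?_) fun k hk => ?_
    · simpa [he] using ha v
    · rcases Finset.mem_union.1 hk with hk | hk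
      · obtain rfl := Finset.mem_singleton.1 hk
        simp [hx, hai]
      · rw [hxC k hk fun h => hiC (h ▸ hk), haC k hk]
  have h2 : 0 < margin P ({j} ∪ C) x := by
    refine margin_pos hP.1 (y := fun k => e k false) ((hsupp _).2 fun v => ?_) fun k hk => ?_
    · simpa [he] using hzero v
    · rcases Finset.mem_union.1 hk with hk | hk
      · obtain rfl := Finset.mem_singleton.1 hk
        simp [hx, hij.symm]
      · rw [hxC k hk fun h => hiC (h ▸ hk)]
  have := hCI x
  rw [h0, zero_mul] at this
  exact (mul_pos h1 h2).ne this

/-- Completeness of d-separation: along a cheapest d-connecting walk, non-colliders copy their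
parent on the walk, a collider is active whenever its two neighbours on the walk differ, and
activity of a collider is propagated to `C`. -/
theorem exists_not_condIndep (hE : Acyclic E) (hcard : ∀ i, 2 ≤ Fintype.card (𝒳 i))
    {i j : Fin p} {C : Finset (Fin p)} (hij : i ≠ j) (hi : i ∉ C) (hj : j ∉ C)
    (hsep : ¬ DSep E i j C) :
    ∃ P : (∀ i, 𝒳 i) → ℝ, IsPMF P ∧ Factorizes E P ∧ ¬ CondIndep P {i} {j} C := by
  classical
  rw [dSep_iff_not_conn hE hij hi hj, not_not] at hsep
  obtain ⟨L, g, W⟩ := hsep.exists_optWalk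
  set Col : ℕ → Prop := fun k => k < L ∧ (g k).2 = true ∧ (g (k + 1)).2 = false with hCol
  set copy : Fin p → Fin p → Prop := fun u v => ∃ t < L,
    ((g (t + 1)).2 = true ∧ ¬ Col (t + 1) ∧ u = (g t).1 ∧ v = (g (t + 1)).1) ∨
    ((g (t + 1)).2 = false ∧ ¬ Col t ∧ u = (g (t + 1)).1 ∧ v = (g t).1) with hcopy
  set active : Fin p → Prop := fun u =>
    ∃ k, Col k ∧ Relation.ReflTransGen (Descent E C) (g k).1 u with hactive
  set allowed : Fin p → (Fin p → Bool) → Prop := fun v a =>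
    (∀ u, copy u v → a v = a u) ∧
    (∀ k, Col (k + 1) → v = (g (k + 1)).1 → a (g k).1 ≠ a (g (k + 2)).1 → a v = true) ∧
    ∀ u, active u → Descent E C u v → a u = true → a v = true with hallowed
  have hCol0 : ¬ Col 0 := fun h => by simp [hCol, W.start] at h
  have hnotCol : ∀ {k}, (g (k + 1)).2 = true → ¬ Col k := fun h h' => by simp [h'.2.2] at h
  have hnotCol' : ∀ {k}, (g k).2 = false → ¬ Col k := fun h h' => by simp [h'.2.1] at h
  have hinj : ∀ {s t}, s ≤ L → t ≤ L → (g s).1 = (g t).1 → s = t := fun hs ht h =>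
    W.fst_injective hj hs ht h
  have hoff : ∀ {u v t}, active u → Descent E C u v → t ≤ L → (g t).1 ≠ v := by
    rintro u v t ⟨k, hk, hku⟩ huv ht
    exact W.fst_ne_of_descent hE hj hk.1 hk.2.1 hk.2.2 (.tail' hku huv) ht
  have hcopyE : ∀ {u v}, copy u v → E u v := by
    rintro u v ⟨t, ht, ⟨h, -, rfl, rfl⟩ | ⟨h, -, rfl, rfl⟩⟩
    · exact W.edge_of_snd ht h
    · exact W.edge_of_not_snd ht h
  have hcopyU : ∀ {u u' v}, copy u v → copy u' v → u = u' := by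
    rintro u u' v ⟨t, ht, ⟨h, hc, rfl, rfl⟩ | ⟨h, hc, rfl, rfl⟩⟩
      ⟨t', ht', ⟨h', hc', rfl, he⟩ | ⟨h', hc', rfl, he⟩⟩
    · obtain rfl : t = t' := by have := hinj (by omega) (by omega) he; omega
      rfl
    · obtain rfl := hinj (by omega) (by omega) he
      exact absurd ⟨ht', h, h'⟩ hc'
    · obtain rfl := hinj (by omega) (by omega) he
      exact absurd ⟨ht, h', h⟩ hc
    · obtain rfl := hinj (by omega) (by omega) he
      rfl
  have hcopyC : ∀ {u k}, Col k → ¬ copy u (g k).1 := by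
    rintro u k hk ⟨t, ht, ⟨-, hc, -, he⟩ | ⟨-, hc, -, he⟩⟩
    · obtain rfl := hinj hk.1.le (by omega) he
      exact hc hk
    · obtain rfl := hinj hk.1.le (by omega) he
      exact hc hk
  have hcopyD : ∀ {u u' v}, active u → Descent E C u v → ¬ copy u' v := by
    rintro u u' v hu huv ⟨t, ht, ⟨-, -, -, rfl⟩ | ⟨-, -, -, rfl⟩⟩
    · exact hoff hu huv ht rfl
    · exact hoff hu huv ht.le rfl
  refine exists_not_condIndep_of_constraints hE hcard hij hj allowed ?_ ?_ ?_ ?_ ?_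
  · intro v a b hv hab
    have h1 : ∀ k, Col (k + 1) → v = (g (k + 1)).1 →
        a (g k).1 = b (g k).1 ∧ a (g (k + 2)).1 = b (g (k + 2)).1 := by
      rintro k hk rfl
      have := hk.1
      exact ⟨hab _ (W.edge_of_snd (by omega) hk.2.1), hab _ (W.edge_of_not_snd hk.1 hk.2.2)⟩
    refine and_congr (forall₂_congr fun u hu => by rw [hv, hab u (hcopyE hu)])
      (and_congr (forall₃_congr fun k hk hvk => by rw [hv, (h1 k hk hvk).1, (h1 k hk hvk).2])
        (forall₃_congr fun u _ huv => by rw [hv, hab u huv.1]))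
  · intro v a
    by_cases h : ∃ u, copy u v
    · obtain ⟨u, hu⟩ := h
      refine ⟨a u, fun u' hu' => ?_, fun k hk hvk => ?_, fun w hw hwv => ?_⟩
      · obtain rfl := hcopyU hu hu'
        have : u ≠ v := by
          rintro rfl
          exact hE u (.single (hcopyE hu))
        simp [this]
      · exact absurd (hvk ▸ hu) (hcopyC hk)
      · exact absurd hu (hcopyD hw hwv)
    · exact ⟨true, fun u hu => absurd ⟨u, hu⟩ h, fun _ _ _ _ => by simp, fun _ _ _ _ => by simp⟩
  · exact fun v => ⟨fun _ _ => rfl, fun _ _ _ h => absurd rfl h, fun _ _ _ h => h⟩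
  · refine ⟨fun v => decide (∃ t ≤ L, ¬ Col t ∧ (g t).1 = v), fun v => ⟨?_, ?_, ?_⟩, ?_, ?_⟩
    · rintro u ⟨t, ht, ⟨h, hc, rfl, rfl⟩ | ⟨h, hc, rfl, rfl⟩⟩
      · exact (decide_eq_true ⟨t + 1, ht, hc, rfl⟩).trans
          (decide_eq_true ⟨t, ht.le, hnotCol h, rfl⟩).symm
      · exact (decide_eq_true ⟨t, ht.le, hc, rfl⟩).trans
          (decide_eq_true ⟨t + 1, ht, hnotCol' h, rfl⟩).symm
    · intro k hk _ hne
      refine absurd ?_ hne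
      have := hk.1
      exact (decide_eq_true ⟨k, by omega, hnotCol hk.2.1, rfl⟩).trans
        (decide_eq_true ⟨k + 2, hk.1, hnotCol' hk.2.2, rfl⟩).symm
    · rintro u ⟨k, hk, hku⟩ - h
      obtain ⟨t, ht, hc, rfl⟩ := of_decide_eq_true h
      exfalso
      rcases Relation.reflTransGen_iff_eq_or_transGen.1 hku with he | htr
      · obtain rfl := hinj ht hk.1.le he
        exact hc hk
      · exact W.fst_ne_of_descent hE hj hk.1 hk.2.1 hk.2.2 htr ht rfl
    · exact decide_eq_true ⟨0, by omega, hCol0, by simp [W.start]⟩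
    · intro k hk
      refine decide_eq_false ?_
      rintro ⟨t, ht, hc, rfl⟩
      rcases ht.eq_or_lt with rfl | ht
      · exact hj (W.fst_last ▸ hk)
      · exact W.notMem ht (fun h => hc ⟨ht, h⟩) hk
  · intro a ha hai haC
    have hact : ∀ n u, depth E C u = n → ToSet E C u → active u → a u = false := by
      intro n
      induction n with
      | zero =>
        rintro u hn hu -
        rcases hu.mem_or_descent with h | ⟨w, h⟩
        · exact haC u h
        · have := h.2.2
          omega
      | succ n ih =>
        intro u hn hu hau
        rcases hu.mem_or_descent with h | ⟨w, h⟩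
        · exact haC u h
        · have hd := h.2.2
          obtain ⟨k, hk, hku⟩ := hau
          have hw := ih w (by omega) h.2.1 ⟨k, hk, hku.tail h⟩
          by_contra hne
          have := (ha w).2.2 u ⟨k, hk, hku⟩ h (by simpa using hne)
          simp [hw] at this
    have key : ∀ t ≤ L, ¬ Col t → a (g t).1 = true := by
      intro t
      induction t using Nat.strong_induction_on with
      | _ t ih =>
      intro ht hc
      rcases t with _ | t
      · simpa [W.start] using hai
      by_cases hct : Col t
      · rcases t with _ | t
        · exact absurd hct hCol0
        have hprev := ih t (by omega) (by omega) (hnotCol hct.2.1)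
        have hcol := hact _ _ rfl (W.bounce hct.1 hct.2.1 hct.2.2).1 ⟨_, hct, .refl⟩
        by_contra hne
        have := (ha _).2.1 t hct rfl fun h => hne (h ▸ hprev)
        simp [hcol] at this
      · have hprev := ih t (by omega) (by omega) hct
        cases hb : (g (t + 1)).2 with
        | true => rw [(ha _).1 _ ⟨t, ht, .inl ⟨hb, hc, rfl, rfl⟩⟩, hprev]
        | false => rw [← (ha _).1 _ ⟨t, ht, .inr ⟨hb, hct, rfl, rfl⟩⟩, hprev]
    have := key L le_rfl fun h => lt_irrefl _ h.1
    rwa [W.fst_last] at this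

end Completeness

/-- If every pmf factorizing according to `E` factorizes according to `E'`, then every
d-separation of `E'` holds in `E`. -/
theorem indep_subset_of_factorizes (hcard : ∀ i, 2 ≤ Fintype.card (𝒳 i))
    {E E' : Fin p → Fin p → Prop} (hE : Acyclic E) (hE' : Acyclic E')
    (h : ∀ P : (∀ i, 𝒳 i) → ℝ, IsPMF P → Factorizes E P → Factorizes E' P) :
    Indep E' ⊆ Indep E := by
  rintro ⟨i, j, C⟩ ⟨hij, hi, hj, hsep⟩
  refine ⟨hij, hi, hj, ?_⟩
  by_contra hconn
  obtain ⟨P, hP, hfac, hCI⟩ := exists_not_condIndep hE hcard hij hi hj hconn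
  exact hCI ((h P hP hfac).isIMAP hE' i j C hij hi hj hsep)

theorem factorizes_of_indep_subset {E E' : Fin p → Fin p → Prop} (hE : Acyclic E)
    (hE' : Acyclic E') (h : Indep E' ⊆ Indep E) {P : (∀ i, 𝒳 i) → ℝ} (hP : IsPMF P)
    (hfac : Factorizes E P) : Factorizes E' P := by
  refine IsIMAP.factorizes hE' hP fun i j C hij hi hj hsep => ?_
  have hmem : (i, j, C) ∈ Indep E := h ⟨hij, hi, hj, hsep⟩
  exact hfac.isIMAP hE i j C hij hi hj hmem.2.2.2

/-- For finite sets `𝒳 i` of cardinality at least 2, two DAGs `G` and `G'` on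
`Fin p` admit the same set of factorizing pmfs on `∏ i, 𝒳 i` if and only if they
are Markov equivalent. -/
theorem factorization_model_eq_iff_markovEquiv
    (hcard : ∀ i, 2 ≤ Fintype.card (𝒳 i))
    (G G' : Fin p → Fin p → Prop) (hG : Acyclic G) (hG' : Acyclic G') :
    {P : (∀ i, 𝒳 i) → ℝ | IsPMF P ∧ Factorizes G P} =
        {P : (∀ i, 𝒳 i) → ℝ | IsPMF P ∧ Factorizes G' P} ↔
      MarkovEquiv G G' := by
  constructor
  · intro h
    refine Set.Subset.antisymm ?_ ?_
    · exact indep_subset_of_factorizes hcard hG' hG fun P hP hfac =>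
        ((Set.ext_iff.1 h P).2 ⟨hP, hfac⟩).2
    · exact indep_subset_of_factorizes hcard hG hG' fun P hP hfac =>
        ((Set.ext_iff.1 h P).1 ⟨hP, hfac⟩).2
  · intro h
    ext P
    exact and_congr_right fun hP =>
      ⟨factorizes_of_indep_subset hG hG' (Eq.subset (Eq.symm h)) hP,
        factorizes_of_indep_subset hG' hG (Eq.subset h) hP⟩

end CausalDiscovery
end

section
/- (Graphical characterization of interventional Markov equivalence.) Let T_1, …, T_M ⊆ Fin p be intervention target sets and let G, G' be DAGs on Fin p. Then the I-DAGs of (G; T_1,…,T_M) and (G'; T_1,…,T_M) are Markov equivalent (have equal d-separation triples) if and only if: (1) G and G' have the same skeleton and the same v-structures, and (2) for every m and every i ∈ T_m and j ∉ T_m, the edge j → i is in G if and only if j → i is in G'. -/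
namespace CausalDiscovery

variable {V : Type*}

/-- The edge relation of the I-DAG of `(E; T)`: the vertex set is `Fin p ⊕ Fin M`,
the edges are the edges of `E` together with an edge `ζ_m → i` for every `m` and
every `i ∈ T m`. -/
def IDagEdge {p M : ℕ} (E : Fin p → Fin p → Prop) (T : Fin M → Finset (Fin p)) :
    Fin p ⊕ Fin M → Fin p ⊕ Fin M → Prop
  | Sum.inl i, Sum.inl j => E i j
  | Sum.inr m, Sum.inl i => i ∈ T m
  | _, _ => False

section DSeparation

variable {E E' : V → V → Prop} {C : Finset V} {i j : V}

lemma Acyclic.asymm_s11 (hE : Acyclic E) {a b : V} (h : E a b) : ¬ E b a :=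
  fun h' => hE a (.tail (.single h) h')

lemma Acyclic.irrefl (hE : Acyclic E) (a : V) : ¬ E a a :=
  fun h => hE a (.single h)

lemma Acyclic.of_trans_adj (hE : Acyclic E) {a b c : V} (hab : E a b) (hbc : E b c)
    (hac : Adj E a c) : E a c :=
  hac.resolve_right fun h => hE a (.tail (.tail (.single hab) hbc) h)

lemma Adj.symm {a b : V} (h : Adj E a b) : Adj E b a := Or.symm h

/-- `v` is in `C` or has a descendant in `C`. -/
def AncOf (E : V → V → Prop) (C : Finset V) (v : V) : Prop :=
  ∃ d ∈ C, Desc E v d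

lemma AncOf.of_mem {v : V} (h : v ∈ C) : AncOf E C v := ⟨v, h, .refl⟩

lemma AncOf.of_edge {v w : V} (h : E v w) (hw : AncOf E C w) : AncOf E C v :=
  let ⟨d, hd, hwd⟩ := hw
  ⟨d, hd, .head h hwd⟩

lemma AncOf.of_transGen {v w : V} (h : Relation.TransGen E v w) (hw : AncOf E C w) :
    AncOf E C v :=
  let ⟨d, hd, hwd⟩ := hw
  ⟨d, hd, h.to_reflTransGen.trans hwd⟩

/-- The consecutive vertices `a, b, c` of a walk do not block it at `b` given `C`. -/
def Open (E : V → V → Prop) (C : Finset V) (a b c : V) : Prop :=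
  (E a b ∧ E c b → AncOf E C b) ∧ (¬ (E a b ∧ E c b) → b ∉ C)

lemma Open.symm {a b c : V} (h : Open E C a b c) : Open E C c b a :=
  ⟨fun hc => h.1 hc.symm, fun hc => h.2 fun hc' => hc hc'.symm⟩

/-- Bypassing the middle vertex `b` of a shielded triple `a, b, c` keeps a walk open at `a`,
unless `b` is a source of the triple and `a` is a collider. -/
lemma Open.bypass (hE : Acyclic E) {x a b c : V} (oa : Open E C x a b) (ob : Open E C a b c)
    (hab : Adj E a b) (hbc : Adj E b c) (hac : Adj E a c)
    (hn : ¬ (E b a ∧ E b c ∧ E x a)) : Open E C x a c := by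
  by_cases hx : E x a
  · rcases hab with hab | hba
    · refine ⟨fun hc => ?_, fun _ => oa.2 fun h => hE.asymm_s11 hab h.2⟩
      exact .of_edge hab (ob.1 ⟨hab, hE.of_trans_adj hc.2 hab hbc.symm⟩)
    · have hcb : E c b := hbc.resolve_left fun h => hn ⟨hba, h, hx⟩
      have hca := hE.of_trans_adj hcb hba hac.symm
      exact ⟨fun _ => oa.1 ⟨hx, hba⟩, fun h => absurd ⟨hx, hca⟩ h⟩
  · exact ⟨fun h => absurd h.1 hx, fun _ => oa.2 fun h => hx h.1⟩

/-- `f 0, …, f n` is a (not necessarily injective) walk from `i` to `j` that d-connects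
its endpoints given `C`. -/
structure OpenWalk (E : V → V → Prop) (C : Finset V) (i j : V) (n : ℕ) (f : ℕ → V) : Prop where
  start : f 0 = i
  finish : f n = j
  adj : ∀ t, t < n → Adj E (f t) (f (t + 1))
  isOpen : ∀ t, t + 2 ≤ n → Open E C (f t) (f (t + 1)) (f (t + 2))

lemma dConn_iff {n : ℕ} {f : ℕ → V} :
    DConn E n f C ↔ ∀ t, t + 2 ≤ n → Open E C (f t) (f (t + 1)) (f (t + 2)) := by
  have key : ∀ t, (f t ∈ C ∨ ∃ d ∈ C, Desc E (f t) d) ↔ AncOf E C (f t) := fun t =>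
    ⟨fun h => h.elim AncOf.of_mem id, Or.inr⟩
  constructor
  · intro h t ht
    have := h (t + 1) (by omega) (by omega)
    rw [key] at this
    exact this
  · intro h t h0 ht
    obtain ⟨s, rfl⟩ : ∃ s, t = s + 1 := ⟨t - 1, by omega⟩
    rw [key]
    exact h s (by omega)

/-- A walk that starts along the direction of an edge is directed, or it has a collider which
is a descendant of its start. -/
lemma directed_or_collider {f : ℕ → V} {s : ℕ} (h0 : E (f s) (f (s + 1))) (k : ℕ)
    (hadj : ∀ t, t ≤ k → Adj E (f (s + t)) (f (s + t + 1))) :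
    (Relation.TransGen E (f s) (f (s + k + 1)) ∧ E (f (s + k)) (f (s + k + 1))) ∨
      ∃ u, u < k ∧ E (f (s + u)) (f (s + u + 1)) ∧ E (f (s + u + 2)) (f (s + u + 1)) ∧
        Relation.TransGen E (f s) (f (s + u + 1)) := by
  induction k with
  | zero => exact .inl ⟨.single h0, h0⟩
  | succ k ih =>
    rcases ih fun t ht => hadj t (by omega) with ⟨h1, h2⟩ | ⟨u, hu, h⟩
    · rcases hadj (k + 1) le_rfl with h | h
      · exact .inl ⟨.tail h1 h, h⟩
      · exact .inr ⟨k, by omega, h2, h, h1⟩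
    · exact .inr ⟨u, by omega, h⟩

/-- Omitting the `k` vertices after position `s` from a d-connecting walk. -/
lemma OpenWalk.splice {n s k : ℕ} {f : ℕ → V} (h : OpenWalk E C i j n f) (hs : s + k + 1 ≤ n)
    (hadj : Adj E (f s) (f (s + k + 1)))
    (h1 : ∀ u, u + 1 = s → Open E C (f u) (f s) (f (s + k + 1)))
    (h2 : s + k + 2 ≤ n → Open E C (f s) (f (s + k + 1)) (f (s + k + 2))) :
    OpenWalk E C i j (n - k) (fun u => if u ≤ s then f u else f (u + k)) where
  start := by simpa using h.start
  finish := by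
    rw [if_neg (by omega), Nat.sub_add_cancel (by omega)]
    exact h.finish
  adj t ht := by
    rcases lt_trichotomy t s with hlt | rfl | hgt
    · simpa [hlt.le, Nat.succ_le_of_lt hlt] using h.adj t (by omega)
    · simpa [add_right_comm] using hadj
    · simpa [show ¬ t ≤ s by omega, show ¬ t + 1 ≤ s by omega, add_right_comm]
        using h.adj (t + k) (by omega)
  isOpen t ht := by
    rcases lt_trichotomy (t + 1) s with hlt | heq | hgt
    · simpa [show t ≤ s by omega, show t + 1 ≤ s by omega, show t + 2 ≤ s by omega]
        using h.isOpen t (by omega)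
    · have := h1 t heq
      subst heq
      simpa [show t + 2 + k = t + 1 + k + 1 by omega] using this
    · obtain rfl | hgt : t = s ∨ s < t := by omega
      · simpa [show t + 2 + k = t + k + 2 by omega, show t + 1 + k = t + k + 1 by omega]
          using h2 (by omega)
      · simpa [show ¬ t ≤ s by omega, show ¬ t + 1 ≤ s by omega, show ¬ t + 2 ≤ s by omega,
          show t + 2 + k = t + k + 2 by omega, show t + 1 + k = t + k + 1 by omega]
          using h.isOpen (t + k) (by omega)

/-- A shortest d-connecting walk is a path. -/
lemma OpenWalk.ne_of_minimal {n : ℕ} {f : ℕ → V} (h : OpenWalk E C i j n f)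
    (hmin : ∀ n' f', OpenWalk E C i j n' f' → n ≤ n') :
    ∀ s t, s < t → t ≤ n → f s ≠ f t := by
  intro s t hst htn heq
  obtain rfl | htn := htn.eq_or_lt
  · have := hmin s f ⟨h.start, heq.trans h.finish, fun u hu => h.adj u (by omega),
      fun u hu => h.isOpen u (by omega)⟩
    omega
  obtain ⟨k, rfl⟩ : ∃ k, t = s + k + 1 := ⟨t - s - 1, by omega⟩
  suffices ∃ g, OpenWalk E C i j (n - (k + 1)) g by
    obtain ⟨g, hg⟩ := this
    have := hmin _ _ hg
    omega
  refine ⟨_, h.splice (s := s) (by omega) ?_ ?_ ?_⟩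
  · rw [heq]; exact h.adj _ htn
  · rintro u rfl
    have o1 := h.isOpen u (by omega)
    have o2 := h.isOpen (u + 1 + k) (by omega)
    change Open E C (f u) (f (u + 1)) (f (u + 1 + k + 2))
    refine ⟨fun ⟨ha, hb⟩ => ?_, fun hn => ?_⟩
    · by_cases c1 : E (f (u + 2)) (f (u + 1))
      · exact o1.1 ⟨ha, c1⟩
      have e1 : E (f (u + 1)) (f (u + 1 + 1)) := (h.adj (u + 1) (by omega)).resolve_right c1
      rcases directed_or_collider e1 k (fun t ht => h.adj _ (by omega)) with ⟨-, h2⟩ | ⟨v, hv, h3⟩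
      · rw [heq] at hb ⊢
        exact o2.1 ⟨h2, hb⟩
      · exact AncOf.of_transGen h3.2.2 ((h.isOpen (u + 1 + v) (by omega)).1 ⟨h3.1, h3.2.1⟩)
    · by_cases c1 : E (f u) (f (u + 1))
      · rw [heq] at hn ⊢
        refine o2.2 fun hc => hn ⟨?_, hc.2⟩
        rwa [heq] at c1
      · exact o1.2 fun hc => c1 hc.1
  · intro hn
    have := h.isOpen (s + k + 1) (by omega)
    rwa [← heq] at this

/-- On a shortest d-connecting walk, the middle vertex of a shielded triple is a source of the
triple, and bypassing it would turn a collider into a non-collider. -/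
lemma OpenWalk.shielded (hE : Acyclic E) {n : ℕ} {f : ℕ → V} (h : OpenWalk E C i j n f)
    (hmin : ∀ n' f', OpenWalk E C i j n' f' → n ≤ n') {t : ℕ} (ht : t + 2 ≤ n)
    (hac : Adj E (f t) (f (t + 2))) :
    E (f (t + 1)) (f t) ∧ E (f (t + 1)) (f (t + 2)) ∧
      ((∃ u, u + 1 = t ∧ E (f u) (f t)) ∨ (t + 3 ≤ n ∧ E (f (t + 3)) (f (t + 2)))) := by
  by_contra hcon
  suffices ∃ g, OpenWalk E C i j (n - 1) g by
    obtain ⟨g, hg⟩ := this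
    have := hmin _ _ hg
    omega
  have hab := h.adj t (by omega)
  have hbc := h.adj (t + 1) (by omega)
  have ob := h.isOpen t ht
  refine ⟨_, h.splice (s := t) (by omega) hac ?_ ?_⟩
  · rintro u rfl
    exact (h.isOpen u (by omega)).bypass hE ob hab hbc hac
      fun ⟨h1, h2, h3⟩ => hcon ⟨h1, h2, .inl ⟨u, rfl, h3⟩⟩
  · intro hn
    exact ((h.isOpen (t + 1) (by omega)).symm.bypass hE ob.symm hbc.symm hab.symm hac.symm
      fun ⟨h1, h2, h3⟩ => hcon ⟨h2, h1, .inr ⟨hn, h3⟩⟩).symm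

/-- There is a directed path with `k` edges from `v` to `C`. -/
def Reaches (E : V → V → Prop) (C : Finset V) : ℕ → V → Prop
  | 0, v => v ∈ C
  | k + 1, v => ∃ w, E v w ∧ Reaches E C k w

lemma ancOf_iff_exists_reaches {v : V} : AncOf E C v ↔ ∃ k, Reaches E C k v := by
  constructor
  · rintro ⟨d, hd, h⟩
    induction h using Relation.ReflTransGen.head_induction_on with
    | refl => exact ⟨0, hd⟩
    | head h _ ih => exact ih.imp' (· + 1) fun k hk => ⟨_, h, hk⟩
  · rintro ⟨k, hk⟩
    induction k generalizing v with
    | zero => exact .of_mem hk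
    | succ k ih => exact let ⟨w, hw, hk⟩ := hk; .of_edge hw (ih hk)

/-- The length of a shortest directed path from `v` to `C`. -/
noncomputable def ancDist (E : V → V → Prop) (C : Finset V) (v : V) : ℕ :=
  sInf {k | Reaches E C k v}

lemma ancDist_le {v : V} {k : ℕ} (h : Reaches E C k v) : ancDist E C v ≤ k := Nat.sInf_le h

lemma AncOf.reaches {v : V} (h : AncOf E C v) : Reaches E C (ancDist E C v) v :=
  Nat.sInf_mem (ancOf_iff_exists_reaches.1 h)

lemma ancDist_le_succ {v w : V} (h : E v w) (hw : AncOf E C w) :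
    ancDist E C v ≤ ancDist E C w + 1 :=
  ancDist_le ⟨w, h, hw.reaches⟩

lemma AncOf.exists_step {v : V} (h : AncOf E C v) (hv : v ∉ C) :
    ∃ w, E v w ∧ AncOf E C w ∧ ancDist E C v = ancDist E C w + 1 := by
  have hr := h.reaches
  rcases hk : ancDist E C v with _ | k
  · rw [hk] at hr
    exact absurd hr hv
  · rw [hk] at hr
    obtain ⟨w, hw, hkw⟩ := hr
    have hA : AncOf E C w := ancOf_iff_exists_reaches.2 ⟨k, hkw⟩
    have := ancDist_le hkw
    have := ancDist_le_succ hw hA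
    exact ⟨w, hw, hA, by omega⟩

/-- An unshielded non-collider whose first edge is preserved has its second edge preserved. -/
lemma edge_of_unshielded (hE : Acyclic E) (hskel : SameSkeleton E E')
    (hv : VStruct E = VStruct E') {a b c : V} (hbc : E b c) (hac : ¬ Adj E a c) (hne : a ≠ c)
    (hab' : E' a b) : E' b c := by
  refine ((hskel b c).1 (.inl hbc)).resolve_right fun h => hE.asymm_s11 hbc ?_
  have : (a, b, c) ∈ VStruct E' := ⟨hab', h, hne, fun h => hac ((hskel a c).2 h)⟩
  rw [← hv] at this
  exact this.2.1

/-- If the first edge of a shortest directed path to `C` is preserved, so is the whole path. -/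
lemma AncOf.transfer (hE : Acyclic E) (hskel : SameSkeleton E E')
    (hv : VStruct E = VStruct E') {v w : V} (hvw : E v w) (hvw' : E' v w) (hw : AncOf E C w)
    (hd : ancDist E C v = ancDist E C w + 1) : AncOf E' C w := by
  induction hk : ancDist E C w generalizing v w with
  | zero =>
    have := hw.reaches
    rw [hk] at this
    exact .of_mem this
  | succ k ih =>
    by_cases hwC : w ∈ C
    · exact .of_mem hwC
    obtain ⟨x, hwx, hx, hdx⟩ := hw.exists_step hwC
    have hvx : ¬ Adj E v x := fun h => by
      have := ancDist_le_succ (hE.of_trans_adj hvw hwx h) hx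
      omega
    have hne : v ≠ x := by
      rintro rfl
      exact hE.asymm_s11 hvw hwx
    have hwx' := edge_of_unshielded hE hskel hv hwx hvx hne hvw'
    exact .of_edge hwx' (ih hwx hwx' hx hdx (by omega))

/-- d-connecting walks transfer between DAGs with the same skeleton and v-structures. -/
lemma OpenWalk.exists_path (hE : Acyclic E) (hE' : Acyclic E') (hskel : SameSkeleton E E')
    (hv : VStruct E = VStruct E') (hij : i ≠ j) {n₀ : ℕ} {f₀ : ℕ → V}
    (h₀ : OpenWalk E C i j n₀ f₀) : ∃ n f, IsPath E' n f i j ∧ DConn E' n f C := by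
  classical
  have hex : ∃ n f, OpenWalk E C i j n f := ⟨n₀, f₀, h₀⟩
  obtain ⟨n, ⟨f₁, h₁⟩, hmin⟩ : ∃ n, (∃ f, OpenWalk E C i j n f) ∧
      ∀ n' f', OpenWalk E C i j n' f' → n ≤ n' :=
    ⟨Nat.find hex, Nat.find_spec hex, fun n' f' h => Nat.find_min' hex ⟨f', h⟩⟩
  obtain ⟨f, h, hfmin⟩ : ∃ f, OpenWalk E C i j n f ∧ ∀ f', OpenWalk E C i j n f' →
      ∑ t ∈ Finset.range n, ancDist E C (f t) ≤ ∑ t ∈ Finset.range n, ancDist E C (f' t) := by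
    let μ : (ℕ → V) → ℕ := fun f => ∑ t ∈ Finset.range n, ancDist E C (f t)
    obtain ⟨f, hf, hle⟩ := exists_minimalFor_of_wellFoundedLT (OpenWalk E C i j n) μ ⟨f₁, h₁⟩
    exact ⟨f, hf, fun f' h' => (le_total (μ f) (μ f')).elim id (hle h')⟩
  have hinj := h.ne_of_minimal hmin
  have hcol : ∀ t, t + 2 ≤ n → E (f t) (f (t + 1)) → E (f (t + 2)) (f (t + 1)) →
      (f t, f (t + 1), f (t + 2)) ∈ VStruct E := fun t ht h1 h2 =>
    ⟨h1, h2, hinj _ _ (by omega) ht, fun hs => hE.asymm_s11 h1 (h.shielded hE hmin ht hs).1⟩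
  have hcol' : ∀ t, t + 2 ≤ n → E' (f t) (f (t + 1)) → E' (f (t + 2)) (f (t + 1)) →
      E (f t) (f (t + 1)) ∧ E (f (t + 2)) (f (t + 1)) := by
    intro t ht h1 h2
    by_cases hs : Adj E (f t) (f (t + 2))
    · exfalso
      obtain ⟨ha, hc, ⟨u, rfl, hu⟩ | ⟨hn, hu⟩⟩ := h.shielded hE hmin ht hs
      · have := hcol u (by omega) hu ha
        rw [hv] at this
        exact hE'.asymm_s11 h1 this.2.1
      · have := hcol (t + 1) (by omega) hc hu
        rw [hv] at this
        exact hE'.asymm_s11 h2 this.1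
    · have : (f t, f (t + 1), f (t + 2)) ∈ VStruct E' :=
        ⟨h1, h2, hinj _ _ (by omega) ht, fun h' => hs ((hskel _ _).2 h')⟩
      rw [← hv] at this
      exact ⟨this.1, this.2.1⟩
  refine ⟨n, f, ⟨?_, h.start, h.finish, ?_, fun t ht => (hskel _ _).1 (h.adj t ht)⟩,
    dConn_iff.2 fun t ht => ⟨fun hc => ?_, fun hc => (h.isOpen t ht).2 fun hc' => hc ?_⟩⟩
  · refine Nat.pos_of_ne_zero ?_
    rintro rfl
    exact hij (h.start.symm.trans h.finish)
  · intro s t hs ht heq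
    rcases lt_trichotomy s t with hlt | rfl | hlt
    · exact absurd heq (hinj s t hlt ht)
    · rfl
    · exact absurd heq.symm (hinj t s hlt hs)
  · obtain ⟨h1, h2⟩ := hcol' t ht hc.1 hc.2
    have hanc := (h.isOpen t ht).1 ⟨h1, h2⟩
    by_cases hbC : f (t + 1) ∈ C
    · exact .of_mem hbC
    obtain ⟨d, hbd, hd, hdist⟩ := hanc.exists_step hbC
    suffices hbd' : E' (f (t + 1)) d from
      .of_edge hbd' (.transfer hE hskel hv hbd hbd' hd hdist)
    have hne : ∀ a, E a (f (t + 1)) → a ≠ d := by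
      rintro a ha rfl
      exact hE.asymm_s11 ha hbd
    by_cases had : Adj E (f t) d
    · by_cases hcd : Adj E (f (t + 2)) d
      · exfalso
        have had := hE.of_trans_adj h1 hbd had
        have hcd := hE.of_trans_adj h2 hbd hcd
        have hg : OpenWalk E C i j n (Function.update f (t + 1) d) := by
          refine ⟨?_, ?_, fun s hs => ?_, fun s hs => ?_⟩
          · simpa using h.start
          · rw [Function.update_of_ne (by omega)]
            exact h.finish
          · simp only [Function.update_apply]
            have := h.adj s hs
            split_ifs with e1 e2 e2
            · omega
            · subst e1
              exact .inr hcd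
            · obtain rfl : s = t := by omega
              exact .inl had
            · exact this
          · simp only [Function.update_apply]
            have := h.isOpen s hs
            by_cases e1 : s = t + 1
            · subst e1
              have hne := hE.asymm_s11 h2
              have hne' := hE.asymm_s11 hcd
              simpa [Open, hne, hne'] using this
            · by_cases e2 : s = t
              · subst e2
                simpa [Open, had, hcd] using hd
              · by_cases e3 : s + 1 = t
                · subst e3
                  have hne := hE.asymm_s11 h1
                  have hne' := hE.asymm_s11 had
                  simpa [Open, hne, hne'] using this
                · simpa [e1, e2, e3, show s + 2 ≠ t + 1 by omega] using this
        refine (hfmin _ hg).not_gt (Finset.sum_lt_sum (fun s _ => ?_)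
          ⟨t + 1, by simp; omega, by simp; omega⟩)
        rw [Function.update_apply]
        split_ifs with e
        · subst e; omega
        · exact le_rfl
      · exact edge_of_unshielded hE hskel hv hbd hcd (hne _ h2) hc.2
    · exact edge_of_unshielded hE hskel hv hbd had (hne _ h1) hc.1
  · have := hcol t ht hc'.1 hc'.2
    rw [hv] at this
    exact ⟨this.1, this.2.1⟩

lemma indep_subset (hE : Acyclic E) (hE' : Acyclic E') (hskel : SameSkeleton E E')
    (hv : VStruct E = VStruct E') : Indep E' ⊆ Indep E := by
  rintro ⟨i, j, C⟩ ⟨hij, hi, hj, hsep⟩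
  refine ⟨hij, hi, hj, fun n f hf hc => ?_⟩
  obtain ⟨n', f', hf', hc'⟩ := OpenWalk.exists_path (i := i) (j := j) (C := C) hE hE' hskel hv hij
    ⟨hf.2.1, hf.2.2.1, hf.2.2.2.2, dConn_iff.1 hc⟩
  exact hsep n' f' hf' hc'

/-- In a DAG, the parents of `i` d-separate `i` from its non-adjacent non-descendants. -/
lemma exists_indep_of_not_desc [Finite V] (hE : Acyclic E) (hij : i ≠ j) (hadj : ¬ Adj E i j)
    (hdesc : ¬ Desc E i j) : ∃ C, (i, j, C) ∈ Indep E := by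
  let C : Finset V := (Set.toFinite {v | E v i}).toFinset
  have hC : ∀ v, v ∈ C ↔ E v i := fun v => by simp [C]
  refine ⟨C, hij, fun h => hE.irrefl i ((hC i).1 h), fun h => hadj (.inr ((hC j).1 h)), ?_⟩
  rintro n f ⟨hn, rfl, rfl, -, hf⟩ hc
  rw [dConn_iff] at hc
  have hn2 : n ≠ 1 := by
    rintro rfl
    exact hadj (hf 0 one_pos)
  rcases hf 0 hn with h0 | h0
  · rcases directed_or_collider (s := 0) h0 (n - 1) (fun t ht => hf _ (by omega)) with h | h
    · have := h.1.to_reflTransGen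
      rw [show 0 + (n - 1) + 1 = n by omega] at this
      exact hdesc this
    · obtain ⟨u, hu, h1, h2, h3⟩ := h
      obtain ⟨d, hd, hud⟩ := (hc (0 + u) (by omega)).1 ⟨h1, h2⟩
      exact hE _ (.tail' (h3.to_reflTransGen.trans hud) ((hC d).1 hd))
  · exact (hc 0 (by omega)).2 (fun h => hE.asymm_s11 h0 h.1) ((hC _).2 h0)

lemma exists_indep_or [Finite V] (hE : Acyclic E) (hij : i ≠ j) (hadj : ¬ Adj E i j) :
    ∃ C, (i, j, C) ∈ Indep E ∨ (j, i, C) ∈ Indep E := by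
  by_cases h : Desc E i j
  · have h' : ¬ Desc E j i := fun h' =>
      (Relation.reflTransGen_iff_eq_or_transGen.1 h).elim (fun e => hij e.symm)
        fun h => hE i (h.trans_left h')
    exact (exists_indep_of_not_desc hE hij.symm (fun h => hadj h.symm) h').imp fun _ => .inr
  · exact (exists_indep_of_not_desc hE hij hadj h).imp fun _ => .inl

lemma not_adj_of_indep (h : (i, j, C) ∈ Indep E) : ¬ Adj E i j := by
  intro hadj
  refine h.2.2.2 1 (fun t => if t = 0 then i else j) ⟨one_pos, by simp, by simp, ?_, ?_⟩ ?_
  · intro s t hs ht heq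
    have := h.1
    have := this.symm
    interval_cases s <;> interval_cases t <;> simp_all
  · intro t ht
    interval_cases t
    simpa using hadj
  · intro t h0 h1
    omega

lemma not_open_of_indep (h : (i, j, C) ∈ Indep E) {v : V} (hiv : Adj E i v) (hvj : Adj E v j)
    (hi : i ≠ v) (hj : v ≠ j) : ¬ Open E C i v j := by
  intro ho
  refine h.2.2.2 2 (fun t => if t = 0 then i else if t = 1 then v else j)
    ⟨two_pos, by simp, by simp, ?_, ?_⟩ (dConn_iff.2 ?_)
  · intro s t hs ht heq
    have := h.1
    have := this.symm
    have := hi.symm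
    have := hj.symm
    interval_cases s <;> interval_cases t <;> simp_all
  · intro t ht
    interval_cases t
    · simpa using hiv
    · simpa using hvj
  · intro t ht
    obtain rfl : t = 0 := by omega
    simpa using ho

lemma adj_of_markovEquiv [Finite V] (hE : Acyclic E) (hE' : Acyclic E')
    (h : MarkovEquiv E E') (hadj : Adj E' i j) : Adj E i j := by
  by_contra hn
  have hij : i ≠ j := by
    rintro rfl
    exact hadj.elim (hE'.irrefl i) (hE'.irrefl i)
  obtain ⟨C, hC | hC⟩ := exists_indep_or hE hij hn <;> rw [h] at hC
  · exact not_adj_of_indep hC hadj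
  · exact not_adj_of_indep hC hadj.symm

lemma collider_of_indep (hE : Acyclic E) {k : V} (h : (i, k, C) ∈ Indep E)
    (h' : (i, k, C) ∈ Indep E') (hskel : SameSkeleton E E') (hi : E i j) (hk : E k j) :
    E' i j ∧ E' k j := by
  have hij : i ≠ j := by
    rintro rfl
    exact hE.irrefl i hi
  have hjk : j ≠ k := by
    rintro rfl
    exact hE.irrefl j hk
  by_contra hc
  have h1 := not_open_of_indep h (.inl hi) (.inr hk) hij hjk
  have h2 := not_open_of_indep h' ((hskel _ _).1 (.inl hi)) ((hskel _ _).1 (.inr hk)) hij hjk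
  by_cases hj : j ∈ C
  · exact h1 ⟨fun _ => .of_mem hj, fun h => absurd ⟨hi, hk⟩ h⟩
  · exact h2 ⟨fun h => absurd h hc, fun _ => hj⟩

lemma vStruct_subset [Finite V] (hE : Acyclic E) (h : MarkovEquiv E E')
    (hskel : SameSkeleton E E') : VStruct E ⊆ VStruct E' := by
  rintro ⟨i, j, k⟩ ⟨hi, hk, hik, hadj⟩
  have key : E' i j ∧ E' k j := by
    obtain ⟨C, hC | hC⟩ := exists_indep_or hE hik hadj
    · exact collider_of_indep hE hC (h ▸ hC) hskel hi hk
    · exact (collider_of_indep hE hC (h ▸ hC) hskel hk hi).symm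
  exact ⟨key.1, key.2, hik, fun h => hadj ((hskel _ _).2 h)⟩

/-- **Verma–Pearl**: DAGs are Markov equivalent if and only if they have the same skeleton and
the same v-structures. -/
theorem markovEquiv_iff [Finite V] (hE : Acyclic E) (hE' : Acyclic E') :
    MarkovEquiv E E' ↔ SameSkeleton E E' ∧ VStruct E = VStruct E' := by
  constructor
  · intro h
    have hskel : SameSkeleton E E' := fun i j =>
      ⟨adj_of_markovEquiv hE' hE h.symm, adj_of_markovEquiv hE hE' h⟩
    exact ⟨hskel, (vStruct_subset hE h hskel).antisymm
      (vStruct_subset hE' h.symm fun i j => (hskel i j).symm)⟩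
  · rintro ⟨hskel, hv⟩
    exact (indep_subset hE' hE (fun i j => (hskel i j).symm) hv.symm).antisymm
      (indep_subset hE hE' hskel hv)

end DSeparation

lemma acyclic_iDagEdge {p M : ℕ} (T : Fin M → Finset (Fin p)) {G : Fin p → Fin p → Prop}
    (hG : Acyclic G) : Acyclic (IDagEdge G T) := by
  have key : ∀ {i : Fin p} {y}, Relation.TransGen (IDagEdge G T) (Sum.inl i) y →
      ∃ j, y = Sum.inl j ∧ Relation.TransGen G i j := by
    intro i y h
    induction h with
    | @single y h =>
      rcases y with j | m
      · exact ⟨j, rfl, .single h⟩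
      · exact h.elim
    | @tail x y _ h ih =>
      obtain ⟨j, rfl, hj⟩ := ih
      rcases y with k | m
      · exact ⟨k, rfl, .tail hj h⟩
      · exact h.elim
  rintro (i | m) h
  · obtain ⟨j, hj, hij⟩ := key h
    obtain rfl := Sum.inl_injective hj
    exact hG _ hij
  · obtain ⟨x, -, hx⟩ := Relation.TransGen.tail'_iff.1 h
    rcases x with x | x <;> exact hx.elim


/-- **Yang–Katcoff–Uhler: graphical characterization of interventional Markov
equivalence.** For target sets `T 0, …, T (M-1) ⊆ Fin p` and DAGs `G, G'` on
`Fin p`, the I-DAGs of `(G; T)` and `(G'; T)` are Markov equivalent if and only if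
(1) `G` and `G'` have the same skeleton and the same v-structures, and (2) for
every `m`, `i ∈ T m` and `j ∉ T m`, `j → i` in `G` iff `j → i` in `G'`. -/
theorem idag_markovEquiv_iff {p M : ℕ} (T : Fin M → Finset (Fin p))
    (G G' : Fin p → Fin p → Prop) (hG : Acyclic G) (hG' : Acyclic G') :
    MarkovEquiv (IDagEdge G T) (IDagEdge G' T) ↔
      (SameSkeleton G G' ∧ VStruct G = VStruct G') ∧
        ∀ (m : Fin M) (i j : Fin p), i ∈ T m → j ∉ T m → (G j i ↔ G' j i) := by
  rw [markovEquiv_iff (acyclic_iDagEdge T hG) (acyclic_iDagEdge T hG')]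
  simp only [Set.ext_iff, Prod.forall]
  constructor
  · rintro ⟨hs, hv⟩
    refine ⟨⟨fun i j => hs (.inl i) (.inl j), fun i j k => ?_⟩, fun m i j hi hj => ?_⟩
    · simpa [VStruct, Adj, IDagEdge] using hv (.inl i) (.inl j) (.inl k)
    · simpa [VStruct, Adj, IDagEdge, hi, hj] using hv (.inr m) (.inl i) (.inl j)
  · rintro ⟨⟨hs, hv⟩, hT⟩
    refine ⟨?_, ?_⟩
    · rintro (i | m) (j | l)
      · exact hs i j
      all_goals simp [Adj, IDagEdge]
    · rintro (i | m) (j | l) (k | q)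
      · simpa [VStruct, Adj, IDagEdge] using hv i j k
      · simp [VStruct, Adj, IDagEdge]
        grind
      · simp [VStruct, Adj, IDagEdge]
      · simp [VStruct, Adj, IDagEdge]
      · simp [VStruct, Adj, IDagEdge]
        grind
      all_goals simp [VStruct, Adj, IDagEdge]

end CausalDiscovery
end

section
/- (Worst-case necessity of p−1 single-node interventions.) Let p ≥ 2 and let T_1, …, T_M ⊆ Fin p be singleton target sets with M < p−1 (together with the empty observational target T_0 = ∅). Then there exist two distinct DAGs G ≠ G' on Fin p such that the I-DAGs of (G; T_0,…,T_M) and (G'; T_0,…,T_M) are Markov equivalent. -/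
namespace CausalDiscovery

variable {V : Type*}

/-- The graph whose only edge is `a → b`. -/
def SingleEdge (a b : V) : V → V → Prop :=
  fun i j => i = a ∧ j = b

lemma acyclic_singleEdge {a b : V} (hab : a ≠ b) : Acyclic (SingleEdge a b) := by
  have target {v w : V} (h : Relation.TransGen (SingleEdge a b) v w) : v = a ∧ w = b := by
    induction h with
    | single h => exact h
    | tail _ h ih => exact ⟨ih.1, h.2⟩
  intro v hv
  exact hab ((target hv).1.symm.trans (target hv).2)

section SingleEdge

variable {p M : ℕ} {T : Fin M → Finset (Fin p)} {a b : Fin p}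

lemma adj_idagEdge_singleEdge_symm {x y : Fin p ⊕ Fin M}
    (h : Adj (IDagEdge (SingleEdge a b) T) x y) : Adj (IDagEdge (SingleEdge b a) T) x y := by
  rcases x with i | m <;> rcases y with j | m' <;>
    simp only [Adj, IDagEdge, SingleEdge] at h ⊢ <;> tauto

/-- If `b` is not a target, the colliders with distinct neighbours in the I-DAG of `a → b` are
exactly the vertices hit by two intervention vertices. -/
lemma colliderAt_idagEdge_singleEdge_iff (hb : ∀ m, b ∉ T m) {f : ℕ → Fin p ⊕ Fin M} {t : ℕ}
    (hne : f (t - 1) ≠ f (t + 1)) :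
    ColliderAt (IDagEdge (SingleEdge a b) T) f t ↔
      ∃ m m' i, f (t - 1) = Sum.inr m ∧ f (t + 1) = Sum.inr m' ∧ f t = Sum.inl i ∧
        i ∈ T m ∧ i ∈ T m' := by
  unfold ColliderAt
  generalize f (t - 1) = x at *
  generalize f (t + 1) = y at *
  generalize f t = z at *
  rcases x with i | m <;> rcases y with j | m' <;> rcases z with k | l <;>
    simp [IDagEdge, SingleEdge] at hne ⊢
  · rintro rfl - rfl
    exact absurd rfl hne
  · rintro - rfl
    exact hb m'
  · rintro h - rfl
    exact hb m h

lemma eq_of_desc_idagEdge_singleEdge {i : Fin p} {d : Fin p ⊕ Fin M} (hi : i ≠ a)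
    (h : Desc (IDagEdge (SingleEdge a b) T) (Sum.inl i) d) : d = Sum.inl i := by
  induction h with
  | refl => rfl
  | @tail _ d _ h ih =>
    subst ih
    rcases d with j | m
    · exact absurd h.1 hi
    · exact h.elim

lemma indep_idagEdge_singleEdge_subset (ha : ∀ m, a ∉ T m) (hb : ∀ m, b ∉ T m) :
    Indep (IDagEdge (SingleEdge a b) T) ⊆ Indep (IDagEdge (SingleEdge b a) T) := by
  rintro ⟨i, j, C⟩ ⟨hij, hi, hj, hsep⟩
  refine ⟨hij, hi, hj, ?_⟩
  rintro n f ⟨hn, h0, hend, hinj, hadj⟩ hconn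
  refine hsep n f ⟨hn, h0, hend, hinj, fun t ht => adj_idagEdge_singleEdge_symm (hadj t ht)⟩ ?_
  intro t ht htn
  have hne : f (t - 1) ≠ f (t + 1) := fun h => by
    have := hinj _ _ (by omega) (by omega) h
    omega
  have h := hconn t ht htn
  rw [colliderAt_idagEdge_singleEdge_iff ha hne] at h
  rw [colliderAt_idagEdge_singleEdge_iff hb hne]
  refine ⟨fun hcol => Or.inl ?_, h.2⟩
  rcases h.1 hcol with hC | ⟨d, hd, hdesc⟩
  · exact hC
  · obtain ⟨m, m', k, -, -, hk, hkm, -⟩ := hcol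
    rw [hk] at hdesc ⊢
    have hkb : k ≠ b := fun h => hb m (h ▸ hkm)
    rwa [← eq_of_desc_idagEdge_singleEdge hkb hdesc]

/-- Reversing a single edge between two vertices that are never targeted does not change the
independence model of the I-DAG. -/
lemma markovEquiv_idagEdge_singleEdge (ha : ∀ m, a ∉ T m) (hb : ∀ m, b ∉ T m) :
    MarkovEquiv (IDagEdge (SingleEdge a b) T) (IDagEdge (SingleEdge b a) T) :=
  (indep_idagEdge_singleEdge_subset ha hb).antisymm (indep_idagEdge_singleEdge_subset hb ha)

end SingleEdge

/-- Fewer than `p - 1` singleton targets leave two vertices untargeted. -/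
lemma exists_pair_not_mem_targets {p M : ℕ} (hM : M < p - 1)
    (T : Fin (M + 1) → Finset (Fin p)) (hT0 : T 0 = ∅)
    (hT : ∀ m : Fin (M + 1), m ≠ 0 → (T m).card = 1) :
    ∃ a b : Fin p, a ≠ b ∧ (∀ m, a ∉ T m) ∧ ∀ m, b ∉ T m := by
  have hcard : (Finset.univ.biUnion T).card ≤ M := by
    refine Finset.card_biUnion_le.trans ?_
    rw [Fin.sum_univ_succ, hT0]
    simp [hT _ (Fin.succ_ne_zero _)]
  have hcompl : 1 < ((Finset.univ.biUnion T)ᶜ).card := by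
    rw [Finset.card_compl, Fintype.card_fin]
    omega
  obtain ⟨a, ha, b, hb, hab⟩ := Finset.one_lt_card.mp hcompl
  simp only [Finset.mem_compl, Finset.mem_biUnion, Finset.mem_univ, true_and, not_exists] at ha hb
  exact ⟨a, b, hab, ha, hb⟩

/-- **Worst-case necessity of `p − 1` single-node interventions.** Let `p ≥ 2` and
let `T 1, …, T M` be singleton target sets with `M < p − 1`, together with the
empty observational target `T 0 = ∅`. Then there are two distinct DAGs on `Fin p`
whose I-DAGs are Markov equivalent. -/
theorem singleton_interventions_necessary (p M : ℕ) (hp : 2 ≤ p) (hM : M < p - 1)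
    (T : Fin (M + 1) → Finset (Fin p)) (hT0 : T 0 = ∅)
    (hT : ∀ m : Fin (M + 1), m ≠ 0 → (T m).card = 1) :
    ∃ G G' : Fin p → Fin p → Prop,
      Acyclic G ∧ Acyclic G' ∧ G ≠ G' ∧
        MarkovEquiv (IDagEdge G T) (IDagEdge G' T) := by
  obtain ⟨a, b, hab, ha, hb⟩ := exists_pair_not_mem_targets hM T hT0 hT
  refine ⟨SingleEdge a b, SingleEdge b a, acyclic_singleEdge hab, acyclic_singleEdge hab.symm,
    fun h => ?_, markovEquiv_idagEdge_singleEdge ha hb⟩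
  have hba : SingleEdge b a a b := h ▸ ⟨rfl, rfl⟩
  exact hab hba.1

end CausalDiscovery
end

section
/- (Richardson–Spirtes, maximal completion preserves the independence model.) Let G be a directed ancestral graph on Fin p and let i, j be two non-adjacent vertices such that no set C ⊆ Fin p \ {i,j} m-separates i and j in G. Then the mixed graph G' obtained from G by adding the bidirected edge i ↔ j is again a directed ancestral graph, and G' has exactly the same m-separation triples as G. -/
namespace CausalDiscovery

/-- A directed ancestral graph: directed edges `dir`, bidirected edges `bi`
(symmetric), no self-loops, at most one edge between any pair of vertices, no
directed cycle, and no bidirected edge between a vertex and one of its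
descendants. -/
structure AncestralGraph (V : Type*) where
  dir : V → V → Prop
  bi : V → V → Prop
  bi_symm : ∀ i j, bi i j → bi j i
  bi_irrefl : ∀ i, ¬ bi i i
  not_dir_and_bi : ∀ i j, dir i j → ¬ bi i j
  acyclic : ∀ v, ¬ Relation.TransGen dir v v
  ancestral : ∀ i j, bi i j → ¬ Relation.TransGen dir i j

namespace AncestralGraph

variable {V : Type*} (G : AncestralGraph V)

/-- `i` and `j` are adjacent. -/
def Adj (i j : V) : Prop :=
  G.dir i j ∨ G.dir j i ∨ G.bi i j

/-- The edge between `i` and `j` has an arrowhead at `j`. -/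
def ArrowAt (i j : V) : Prop :=
  G.dir i j ∨ G.bi i j

/-- `j` is a descendant of `i` (reachable by a directed path). -/
def Desc (i j : V) : Prop :=
  Relation.ReflTransGen G.dir i j

/-- `f 0, f 1, …, f n` is a path between `i` and `j`: distinct vertices,
consecutive vertices adjacent. -/
def IsPath (n : ℕ) (f : ℕ → V) (i j : V) : Prop :=
  0 < n ∧ f 0 = i ∧ f n = j ∧
    (∀ s t, s ≤ n → t ≤ n → f s = f t → s = t) ∧
    ∀ t, t < n → G.Adj (f t) (f (t + 1))

/-- The vertex at (interior) position `t` of the path `f` is a collider: both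
incident path edges have an arrowhead at it. -/
def ColliderAt (f : ℕ → V) (t : ℕ) : Prop :=
  G.ArrowAt (f (t - 1)) (f t) ∧ G.ArrowAt (f (t + 1)) (f t)

/-- The path `f 0, …, f n` m-connects its endpoints given `C`. -/
def MConn (n : ℕ) (f : ℕ → V) (C : Finset V) : Prop :=
  ∀ t, 0 < t → t < n →
    (G.ColliderAt f t → f t ∈ C ∨ ∃ d ∈ C, G.Desc (f t) d) ∧
    (¬ G.ColliderAt f t → f t ∉ C)

/-- `i` and `j` are m-separated given `C`. -/
def MSep (i j : V) (C : Finset V) : Prop :=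
  ∀ n f, G.IsPath n f i j → ¬ G.MConn n f C

/-- The independence model of `G`: all m-separation triples. -/
def MIndep : Set (V × V × Finset V) :=
  {x | x.1 ≠ x.2.1 ∧ x.1 ∉ x.2.2 ∧ x.2.1 ∉ x.2.2 ∧ G.MSep x.1 x.2.1 x.2.2}

/-- `G` is maximal: every pair of distinct non-adjacent vertices is m-separated by
some set. -/
def IsMaximal : Prop :=
  ∀ i j, i ≠ j → ¬ G.Adj i j →
    ∃ C : Finset V, i ∉ C ∧ j ∉ C ∧ G.MSep i j C

end AncestralGraph

namespace AncestralGraph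

section Walks

variable {V : Type*} (G : AncestralGraph V)

/-- The passage `a, b, c` of a walk is open at `b` given `C`. -/
def OpenAt (C : Finset V) (a b c : V) : Prop :=
  (G.ArrowAt a b ∧ G.ArrowAt c b → b ∈ C ∨ ∃ d ∈ C, G.Desc b d) ∧
    (¬ (G.ArrowAt a b ∧ G.ArrowAt c b) → b ∉ C)

/-- An oriented edge `d` of a walk may be followed by the oriented edge `e`. -/
def DartStep (C : Finset V) (d e : V × V) : Prop :=
  d.2 = e.1 ∧ G.Adj e.1 e.2 ∧ G.OpenAt C d.1 d.2 e.2

/-- `b` has no descendant in `C`. -/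
def Barren (C : Finset V) (b : V) : Prop :=
  ∀ d ∈ C, ¬ G.Desc b d

variable {G}

theorem Barren.notMem {C : Finset V} {b : V} (h : G.Barren C b) : b ∉ C :=
  fun hb => h b hb Relation.ReflTransGen.refl

theorem Barren.of_desc {C : Finset V} {a b : V} (h : G.Barren C a) (hab : G.Desc a b) :
    G.Barren C b :=
  fun d hd hbd => h d hd (Relation.ReflTransGen.trans hab hbd)

theorem adj_symm {a b : V} (h : G.Adj a b) : G.Adj b a := by
  rcases h with h | h | h
  · exact Or.inr (Or.inl h)
  · exact Or.inl h
  · exact Or.inr (Or.inr (G.bi_symm _ _ h))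

theorem not_arrowAt_of_dir {a b : V} (h : G.dir a b) : ¬ G.ArrowAt b a := by
  rintro (h' | h')
  · exact G.acyclic a ((Relation.TransGen.single h).tail h')
  · exact G.not_dir_and_bi _ _ h (G.bi_symm _ _ h')

theorem dir_of_adj_of_not_arrowAt {a b : V} (h : G.Adj a b) (h' : ¬ G.ArrowAt b a) :
    G.dir a b := by
  rcases h with h | h | h
  · exact h
  · exact absurd (Or.inl h) h'
  · exact absurd (Or.inr (G.bi_symm _ _ h)) h'

theorem bi_of_arrowAt {a b : V} (h : G.ArrowAt a b) (h' : G.ArrowAt b a) : G.bi a b := by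
  rcases h with h | h
  · exact absurd h' (not_arrowAt_of_dir h)
  · exact h

theorem not_arrowAt_self (a : V) : ¬ G.ArrowAt a a := by
  rintro (h | h)
  · exact G.acyclic a (Relation.TransGen.single h)
  · exact G.bi_irrefl a h

theorem not_desc_of_arrowAt {a b : V} (h : G.ArrowAt a b) : ¬ G.Desc b a := by
  intro hd
  rcases Relation.reflTransGen_iff_eq_or_transGen.1 hd with rfl | ht
  · exact not_arrowAt_self _ h
  · rcases h with h | h
    · exact G.acyclic _ (ht.tail h)
    · exact G.ancestral _ _ (G.bi_symm _ _ h) ht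

theorem exists_desc_collider_forward {n : ℕ} {f : ℕ → V}
    (hadj : ∀ t, t < n → G.Adj (f t) (f (t + 1))) {s : ℕ} (hs : s < n)
    (hdir : G.dir (f s) (f (s + 1))) :
    ∃ u, s < u ∧ u ≤ n ∧ G.Desc (f s) (f u) ∧ G.ArrowAt (f (u - 1)) (f u) ∧
      (u = n ∨ G.ColliderAt f u) := by
  obtain ⟨m, hm⟩ : ∃ m, n = s + 1 + m := ⟨n - (s + 1), by omega⟩
  induction m generalizing s with
  | zero =>
    exact ⟨s + 1, by omega, by omega, Relation.ReflTransGen.single hdir, Or.inl hdir,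
      Or.inl (by omega)⟩
  | succ m ih =>
    by_cases hc : G.ColliderAt f (s + 1)
    · exact ⟨s + 1, by omega, by omega, Relation.ReflTransGen.single hdir, Or.inl hdir, Or.inr hc⟩
    · have h1 : G.dir (f (s + 1)) (f (s + 1 + 1)) :=
        dir_of_adj_of_not_arrowAt (hadj _ (by omega)) fun h => hc ⟨Or.inl hdir, h⟩
      obtain ⟨u, hu, hun, hd, ha, hor⟩ := ih (by omega) h1 (by omega)
      exact ⟨u, by omega, hun, Relation.ReflTransGen.head hdir hd, ha, hor⟩

theorem exists_desc_collider_backward {n : ℕ} {f : ℕ → V}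
    (hadj : ∀ t, t < n → G.Adj (f t) (f (t + 1))) {s : ℕ} (hs : s < n)
    (hdir : G.dir (f (s + 1)) (f s)) :
    ∃ u, u ≤ s ∧ G.Desc (f (s + 1)) (f u) ∧ (u = 0 ∨ G.ColliderAt f u) := by
  induction s with
  | zero => exact ⟨0, le_rfl, Relation.ReflTransGen.single hdir, Or.inl rfl⟩
  | succ s ih =>
    by_cases hc : G.ColliderAt f (s + 1)
    · exact ⟨s + 1, le_rfl, Relation.ReflTransGen.single hdir, Or.inr hc⟩
    · have h1 : G.dir (f (s + 1)) (f s) :=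
        dir_of_adj_of_not_arrowAt (adj_symm (hadj s (by omega))) fun h => hc ⟨h, Or.inl hdir⟩
      obtain ⟨u, hu, hd, hor⟩ := ih (by omega) h1
      exact ⟨u, by omega, Relation.ReflTransGen.head hdir hd, hor⟩

/-- An m-connecting walk between distinct vertices can be shortened to an m-connecting path. -/
theorem exists_path_of_walk {C : Finset V} {x y : V} (hxy : x ≠ y) (n : ℕ) :
    ∀ f : ℕ → V, f 0 = x → f n = y → (∀ t, t < n → G.Adj (f t) (f (t + 1))) →
      G.MConn n f C → ¬ G.MSep x y C := by
  induction n using Nat.strong_induction_on with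
  | _ n ih =>
  intro f h0 hn hadj hm hsep
  have hpos : 0 < n := by
    rcases Nat.eq_zero_or_pos n with rfl | h
    · exact absurd (h0.symm.trans hn) hxy
    · exact h
  by_cases hinj : ∀ s t, s ≤ n → t ≤ n → f s = f t → s = t
  · exact hsep n f ⟨hpos, h0, hn, hinj, hadj⟩ hm
  obtain ⟨s, t, hst, htn, hf⟩ : ∃ s t, s < t ∧ t ≤ n ∧ f s = f t := by
    push Not at hinj
    obtain ⟨s, t, hs, ht, hf, hne⟩ := hinj
    rcases Nat.lt_or_gt_of_ne hne with h | h
    · exact ⟨s, t, h, ht, hf⟩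
    · exact ⟨t, s, h, hs, hf.symm⟩
  obtain ⟨m, rfl⟩ : ∃ m, t = s + m := ⟨t - s, by omega⟩
  obtain ⟨l, rfl⟩ : ∃ l, n = s + m + l := ⟨n - (s + m), by omega⟩
  set g : ℕ → V := fun k => if k ≤ s then f k else f (k + m) with hg
  have glo : ∀ k, k ≤ s → g k = f k := fun k hk => by simp [hg, hk]
  have ghi : ∀ k, s ≤ k → g k = f (k + m) := fun k hk => by
    rcases Nat.eq_or_lt_of_le hk with rfl | h
    · rw [glo _ le_rfl, hf]
    · simp [hg, Nat.not_le.2 h]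
  refine ih (s + l) (by omega) g ?_ ?_ ?_ ?_ hsep
  · rw [glo 0 (by omega), h0]
  · rw [ghi _ (by omega), ← hn]; congr 1; omega
  · intro k hk
    rcases Nat.lt_or_ge k s with h | h
    · rw [glo k h.le, glo (k + 1) h]; exact hadj k (by omega)
    · rw [ghi k h, ghi (k + 1) (by omega), show k + 1 + m = k + m + 1 by omega]
      exact hadj _ (by omega)
  · intro k hk0 hk
    change G.OpenAt C (g (k - 1)) (g k) (g (k + 1))
    rcases Nat.lt_trichotomy k s with h | h | h
    · rw [glo _ h.le, glo (k - 1) (by omega), glo (k + 1) h]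
      exact hm k hk0 (by omega)
    · subst h
      rw [glo k le_rfl, glo (k - 1) (by omega), ghi (k + 1) (by omega),
        show k + 1 + m = k + m + 1 by omega]
      have h1 : G.OpenAt C (f (k - 1)) (f k) (f (k + 1)) := hm k hk0 (by omega)
      have h2 : G.OpenAt C (f (k + m - 1)) (f k) (f (k + m + 1)) := by
        have := hm (k + m) (by omega) (by omega)
        rw [OpenAt, hf]; exact this
      refine ⟨fun hc => ?_, fun hc => ?_⟩
      · by_cases c1 : G.ArrowAt (f (k + 1)) (f k)
        · exact h1.1 ⟨hc.1, c1⟩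
        by_cases c2 : G.ArrowAt (f (k + m - 1)) (f k)
        · exact h2.1 ⟨c2, hc.2⟩
        have hd := dir_of_adj_of_not_arrowAt (hadj k (by omega)) c1
        obtain ⟨u, hu, hun, hdesc, ha, hor⟩ := exists_desc_collider_forward
          (n := k + m) (fun t ht => hadj t (by omega)) (by omega) hd
        rcases hor with rfl | hcol
        · rw [← hf] at ha; exact absurd ha c2
        · rcases (hm u (by omega) (by omega)).1 hcol with hC | ⟨d, hd, hud⟩
          · exact Or.inr ⟨_, hC, hdesc⟩
          · exact Or.inr ⟨d, hd, Relation.ReflTransGen.trans hdesc hud⟩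
      · by_cases c1 : G.ArrowAt (f (k - 1)) (f k)
        · exact h2.2 fun h => hc ⟨c1, h.2⟩
        · exact h1.2 fun h => c1 h.1
    · rw [ghi k h.le, ghi (k - 1) (by omega), ghi (k + 1) (by omega),
        show k - 1 + m = k + m - 1 by omega, show k + 1 + m = k + m + 1 by omega]
      exact hm (k + m) (by omega) (by omega)

theorem exists_walk_of_dartSteps {C : Finset V} {x b : V} (hxb : G.Adj x b) {e : V × V}
    (h : Relation.ReflTransGen (G.DartStep C) (x, b) e) :
    ∃ n f, f 0 = x ∧ f n = e.1 ∧ f (n + 1) = e.2 ∧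
      (∀ t, t < n + 1 → G.Adj (f t) (f (t + 1))) ∧ G.MConn (n + 1) f C := by
  induction h with
  | refl =>
    refine ⟨0, fun k => if k = 0 then x else b, by simp, by simp, by simp, ?_, ?_⟩
    · intro t ht
      obtain rfl : t = 0 := by omega
      simpa using hxb
    · intro t h0 h1; omega
  | @tail d e _ hde ih =>
    obtain ⟨n, f, h0, hn, hn1, hadj, hm⟩ := ih
    obtain ⟨h1, h2, h3⟩ := hde
    set g : ℕ → V := fun k => if k ≤ n + 1 then f k else e.2 with hg
    have glo : ∀ k, k ≤ n + 1 → g k = f k := fun k hk => by simp [hg, hk]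
    have ghi : g (n + 1 + 1) = e.2 := by simp [hg]
    refine ⟨n + 1, g, by rw [glo 0 (by omega), h0], by rw [glo _ le_rfl, hn1, h1], ghi, ?_, ?_⟩
    · intro t ht
      rcases Nat.lt_or_ge t (n + 1) with h | h
      · rw [glo t h.le, glo (t + 1) h]; exact hadj t h
      · obtain rfl : t = n + 1 := by omega
        rw [ghi, glo _ le_rfl, hn1, h1]; exact h2
    · intro t ht0 ht
      change G.OpenAt C (g (t - 1)) (g t) (g (t + 1))
      rcases Nat.lt_or_ge t (n + 1) with h | h
      · rw [glo t h.le, glo (t + 1) h, glo (t - 1) (by omega)]; exact hm t ht0 h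
      · obtain rfl : t = n + 1 := by omega
        rw [ghi, glo _ le_rfl, glo (n + 1 - 1) (by omega), Nat.add_sub_cancel, hn, hn1]
        exact h3

theorem dartSteps_down {C : Finset V} {v w : V} (hv : G.Barren C v)
    (h : Relation.TransGen G.dir v w) (a : V) :
    ∃ d, Relation.ReflTransGen (G.DartStep C) (a, v) (d, w) ∧ G.dir d w := by
  have key : ∀ (a u c : V), G.Barren C u → G.dir u c → G.DartStep C (a, u) (u, c) :=
    fun a u c hu huc => ⟨rfl, Or.inl huc, fun h => absurd h.2 (not_arrowAt_of_dir huc),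
      fun _ => hu.notMem⟩
  induction h with
  | single h => exact ⟨v, Relation.ReflTransGen.single (key _ _ _ hv h), h⟩
  | tail h1 h2 ih =>
    obtain ⟨d, hd, _⟩ := ih
    exact ⟨_, hd.tail (key _ _ _ (hv.of_desc h1.to_reflTransGen) h2), h2⟩

theorem dartSteps_up {C : Finset V} {v w : V} (hv : G.Barren C v)
    (h : Relation.TransGen G.dir v w) :
    ∃ c d, G.dir c w ∧ G.dir v d ∧ Relation.ReflTransGen (G.DartStep C) (w, c) (d, v) := by
  induction h using Relation.TransGen.head_induction_on with
  | single h => exact ⟨_, _, h, h, Relation.ReflTransGen.refl⟩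
  | head h _ ih =>
    have hu := hv.of_desc (Relation.ReflTransGen.single h)
    obtain ⟨c, d, hc, hd, hr⟩ := ih hu
    exact ⟨c, _, hc, h, hr.tail ⟨rfl, Or.inr (Or.inl h),
      fun h' => absurd h'.1 (not_arrowAt_of_dir hd), fun _ => hu.notMem⟩⟩

/-- A bidirected path all of whose interior vertices are ancestors of an endpoint yields, given any
set, an open walk between the endpoints with arrowheads at both of them. -/
theorem exists_dartSteps_of_inducing {C : Finset V} {i j : V} {n : ℕ} {f : ℕ → V} (hn : 0 < n)
    (h0 : f 0 = i) (hfn : f n = j) (hbi : ∀ t, t < n → G.bi (f t) (f (t + 1)))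
    (hanc : ∀ t, 0 < t → t < n → G.Desc (f t) i ∨ G.Desc (f t) j) :
    ∃ b a, G.Adj i b ∧ G.ArrowAt b i ∧ G.ArrowAt a j ∧
      Relation.ReflTransGen (G.DartStep C) (i, b) (a, j) := by
  by_contra hno
  have key : ∀ t, t < n → ∃ b a, G.Adj i b ∧ G.ArrowAt b i ∧ G.ArrowAt a (f (t + 1)) ∧
      Relation.ReflTransGen (G.DartStep C) (i, b) (a, f (t + 1)) := by
    intro t
    induction t with
    | zero =>
      intro ht
      have h := hbi 0 ht
      rw [h0] at h
      exact ⟨_, i, Or.inr (Or.inr h), Or.inr (G.bi_symm _ _ h), Or.inr h,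
        Relation.ReflTransGen.refl⟩
    | succ t ih =>
      intro ht
      obtain ⟨b, a, hib, hbi', ha, hr⟩ := ih (by omega)
      have hb := hbi (t + 1) ht
      by_cases hC : G.Barren C (f (t + 1))
      · rcases hanc (t + 1) (by omega) ht with hd | hd
        · rcases Relation.reflTransGen_iff_eq_or_transGen.1 hd with heq | htr
          · rw [← heq] at hb
            exact ⟨_, i, Or.inr (Or.inr hb), Or.inr (G.bi_symm _ _ hb), Or.inr hb,
              Relation.ReflTransGen.refl⟩
          · obtain ⟨c, d, hc, hd, hr'⟩ := dartSteps_up hC htr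
            exact ⟨c, f (t + 1), Or.inr (Or.inl hc), Or.inl hc, Or.inr hb,
              hr'.tail ⟨rfl, Or.inr (Or.inr hb), fun h' => absurd h'.1 (not_arrowAt_of_dir hd),
                fun _ => hC.notMem⟩⟩
        · rcases Relation.reflTransGen_iff_eq_or_transGen.1 hd with heq | htr
          · rw [← heq] at ha hr
            exact absurd ⟨b, a, hib, hbi', ha, hr⟩ hno
          · obtain ⟨d, hr', hd⟩ := dartSteps_down hC htr a
            exact absurd ⟨b, d, hib, hbi', Or.inl hd, hr.trans hr'⟩ hno
      · have hC' : ∃ d ∈ C, G.Desc (f (t + 1)) d := by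
          unfold Barren at hC; push Not at hC; exact hC
        exact ⟨b, f (t + 1), hib, hbi', Or.inr hb, hr.tail ⟨rfl, Or.inr (Or.inr hb),
          fun _ => Or.inr hC', fun h' => absurd ⟨ha, Or.inr (G.bi_symm _ _ hb)⟩ h'⟩⟩
  obtain ⟨m, rfl⟩ : ∃ m, n = m + 1 := ⟨n - 1, by omega⟩
  obtain ⟨b, a, h⟩ := key m (by omega)
  rw [hfn] at h
  exact hno ⟨b, a, h⟩

end Walks

/-- Non-adjacent vertices that cannot be m-separated are not ancestors of each other, and are
joined by a bidirected path all of whose interior vertices are ancestors of an endpoint. -/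
theorem exists_inducing_path {V : Type*} [Fintype V] {G : AncestralGraph V} {i j : V}
    (hadj : ¬ G.Adj i j)
    (hnosep : ∀ C : Finset V, i ∉ C → j ∉ C → ¬ G.MSep i j C) :
    ¬ G.Desc i j ∧ ¬ G.Desc j i ∧ ∃ (n : ℕ) (f : ℕ → V), 0 < n ∧ f 0 = i ∧ f n = j ∧
      (∀ t, t < n → G.bi (f t) (f (t + 1))) ∧
      ∀ t, 0 < t → t < n → G.Desc (f t) i ∨ G.Desc (f t) j := by
  classical
  set C : Finset V := Finset.univ.filter
    fun v => (G.Desc v i ∨ G.Desc v j) ∧ v ≠ i ∧ v ≠ j with hC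
  have hsep := hnosep C (by simp [hC]) (by simp [hC])
  unfold MSep at hsep
  push Not at hsep
  obtain ⟨n, f, ⟨hn, h0, hfn, hinj, hpadj⟩, hm⟩ := hsep
  have hcolanc : ∀ t, 0 < t → t < n → G.ColliderAt f t → G.Desc (f t) i ∨ G.Desc (f t) j := by
    intro t ht htn hc
    rcases (hm t ht htn).1 hc with h | ⟨d, hd, htd⟩
    · exact (Finset.mem_filter.1 h).2.1
    · exact (Finset.mem_filter.1 hd).2.1.imp (Relation.ReflTransGen.trans htd)
        (Relation.ReflTransGen.trans htd)
  have hanc : ∀ t, 0 < t → t < n → G.Desc (f t) i ∨ G.Desc (f t) j := by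
    intro t ht htn
    by_cases hc : G.ColliderAt f t
    · exact hcolanc t ht htn hc
    · by_cases h1 : G.ArrowAt (f (t + 1)) (f t)
      · obtain ⟨s, rfl⟩ : ∃ s, t = s + 1 := ⟨t - 1, by omega⟩
        have hd : G.dir (f (s + 1)) (f s) := dir_of_adj_of_not_arrowAt
          (adj_symm (hpadj s (by omega))) fun h => hc ⟨h, h1⟩
        obtain ⟨u, hu, hdesc, hor⟩ := exists_desc_collider_backward hpadj (by omega) hd
        rcases Nat.eq_zero_or_pos u with rfl | hu0
        · rw [h0] at hdesc; exact Or.inl hdesc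
        · exact (hcolanc u hu0 (by omega) (hor.resolve_left (by omega))).imp
            (Relation.ReflTransGen.trans hdesc) (Relation.ReflTransGen.trans hdesc)
      · have hd := dir_of_adj_of_not_arrowAt (hpadj t htn) h1
        obtain ⟨u, hu, hun, hdesc, _, hor⟩ := exists_desc_collider_forward hpadj htn hd
        rcases Nat.eq_or_lt_of_le hun with rfl | hlt
        · rw [hfn] at hdesc; exact Or.inr hdesc
        · exact (hcolanc u (by omega) hlt (hor.resolve_left (by omega))).imp
            (Relation.ReflTransGen.trans hdesc) (Relation.ReflTransGen.trans hdesc)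
  have hcol : ∀ t, 0 < t → t < n → G.ColliderAt f t := by
    intro t ht htn
    by_contra hc
    refine (hm t ht htn).2 hc (Finset.mem_filter.2 ⟨Finset.mem_univ _, hanc t ht htn, ?_, ?_⟩)
    · intro h
      have := hinj t 0 htn.le (by omega) (h.trans h0.symm)
      omega
    · intro h
      have := hinj t n htn.le le_rfl (h.trans hfn.symm)
      omega
  have hn1 : 1 < n := by
    by_contra h
    obtain rfl : n = 1 := by omega
    have := hpadj 0 hn
    rw [h0, zero_add, hfn] at this
    exact hadj this
  have hfirst : G.ArrowAt i (f 1) := by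
    have := (hcol 1 one_pos hn1).1
    rwa [Nat.sub_self, h0] at this
  have hlast : G.ArrowAt j (f (n - 1)) := by
    have := (hcol (n - 1) (by omega) (by omega)).2
    rwa [Nat.sub_add_cancel hn, hfn] at this
  have hfj : G.Desc (f 1) j := (hanc 1 one_pos hn1).resolve_left (not_desc_of_arrowAt hfirst)
  have hli : G.Desc (f (n - 1)) i :=
    (hanc (n - 1) (by omega) (by omega)).resolve_right (not_desc_of_arrowAt hlast)
  have hnij : ¬ G.Desc i j := fun h =>
    not_desc_of_arrowAt hlast (Relation.ReflTransGen.trans hli h)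
  have hnji : ¬ G.Desc j i := fun h =>
    not_desc_of_arrowAt hfirst (Relation.ReflTransGen.trans hfj h)
  have hbf : G.bi i (f 1) :=
    hfirst.resolve_left fun h => hnij (Relation.ReflTransGen.head h hfj)
  have hbl : G.bi j (f (n - 1)) :=
    hlast.resolve_left fun h => hnji (Relation.ReflTransGen.head h hli)
  refine ⟨hnij, hnji, n, f, hn, h0, hfn, fun t ht => ?_, hanc⟩
  rcases Nat.eq_zero_or_pos t with rfl | ht0
  · rw [h0]; exact hbf
  rcases Nat.lt_or_ge (t + 1) n with h | h
  · exact bi_of_arrowAt (hcol (t + 1) (by omega) h).1 (hcol t ht0 ht).2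
  · obtain rfl : n = t + 1 := by omega
    rw [hfn]; exact G.bi_symm _ _ hbl

/-- The graph obtained by adding a bidirected edge between two non-adjacent vertices neither of
which is an ancestor of the other. -/
def addBi {V : Type*} (G : AncestralGraph V) (i j : V) (hadj : ¬ G.Adj i j)
    (hij : ¬ G.Desc i j) (hji : ¬ G.Desc j i) : AncestralGraph V where
  dir := G.dir
  bi := fun a b => G.bi a b ∨ (a = i ∧ b = j) ∨ (a = j ∧ b = i)
  bi_symm := by
    rintro a b (h | ⟨ha, hb⟩ | ⟨ha, hb⟩)
    · exact Or.inl (G.bi_symm _ _ h)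
    · exact Or.inr (Or.inr ⟨hb, ha⟩)
    · exact Or.inr (Or.inl ⟨hb, ha⟩)
  bi_irrefl := by
    rintro a (h | ⟨rfl, rfl⟩ | ⟨rfl, rfl⟩)
    · exact G.bi_irrefl _ h
    · exact hij Relation.ReflTransGen.refl
    · exact hij Relation.ReflTransGen.refl
  not_dir_and_bi := by
    rintro a b hd (h | ⟨rfl, rfl⟩ | ⟨rfl, rfl⟩)
    · exact G.not_dir_and_bi _ _ hd h
    · exact hadj (Or.inl hd)
    · exact hadj (Or.inr (Or.inl hd))
  acyclic := G.acyclic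
  ancestral := by
    rintro a b (h | ⟨rfl, rfl⟩ | ⟨rfl, rfl⟩) ht
    · exact G.ancestral _ _ h ht
    · exact hij ht.to_reflTransGen
    · exact hji ht.to_reflTransGen

section AddBi

variable {V : Type*} {G : AncestralGraph V} {i j : V} {hadj : ¬ G.Adj i j}
  {hij : ¬ G.Desc i j} {hji : ¬ G.Desc j i}

theorem addBi_arrowAt_iff {a b : V} (h : G.Adj a b) :
    (G.addBi i j hadj hij hji).ArrowAt a b ↔ G.ArrowAt a b := by
  refine ⟨?_, fun h => h.imp_right Or.inl⟩
  rintro (h' | h' | ⟨rfl, rfl⟩ | ⟨rfl, rfl⟩)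
  · exact Or.inl h'
  · exact Or.inr h'
  · exact absurd h hadj
  · exact absurd (adj_symm h) hadj

theorem addBi_openAt_iff {C : Finset V} {a b c a' c' : V}
    (ha : (G.addBi i j hadj hij hji).ArrowAt a b ↔ G.ArrowAt a' b)
    (hc : (G.addBi i j hadj hij hji).ArrowAt c b ↔ G.ArrowAt c' b) :
    (G.addBi i j hadj hij hji).OpenAt C a b c ↔ G.OpenAt C a' b c' := by
  unfold OpenAt
  rw [ha, hc]
  rfl

theorem mSep_of_addBi_mSep {C : Finset V} {x y : V}
    (h : (G.addBi i j hadj hij hji).MSep x y C) : G.MSep x y C := by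
  rintro n f ⟨hn, h0, hfn, hinj, hpadj⟩ hm
  refine h n f ⟨hn, h0, hfn, hinj, fun t ht => ?_⟩ fun t ht0 ht => ?_
  · exact (hpadj t ht).imp_right (Or.imp_right Or.inl)
  · have h1 : G.Adj (f (t - 1)) (f t) := by
      have := hpadj (t - 1) (by omega)
      rwa [Nat.sub_add_cancel ht0] at this
    exact (addBi_openAt_iff (addBi_arrowAt_iff h1)
      (addBi_arrowAt_iff (adj_symm (hpadj t ht)))).2 (hm t ht0 ht)

/-- If the new edge can be replaced, given `C`, by an open walk of `G` with arrowheads at both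
ends, then m-separation given `C` carries over to the completed graph. -/
theorem addBi_mSep_of_mSep {C : Finset V} {x y : V} (hxy : x ≠ y)
    (hwalk : ∃ b a, G.Adj i b ∧ G.ArrowAt b i ∧ G.ArrowAt a j ∧
      Relation.ReflTransGen (G.DartStep C) (i, b) (a, j))
    (hwalk' : ∃ b a, G.Adj j b ∧ G.ArrowAt b j ∧ G.ArrowAt a i ∧
      Relation.ReflTransGen (G.DartStep C) (j, b) (a, i))
    (h : G.MSep x y C) : (G.addBi i j hadj hij hji).MSep x y C := by
  rintro n f ⟨hn, h0, hfn, hinj, hpadj⟩ hm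
  set G' := G.addBi i j hadj hij hji with hG'
  have hedge : ∀ u v, G'.Adj u v → ∃ b a, G.Adj u b ∧ (G'.ArrowAt v u ↔ G.ArrowAt b u) ∧
      (G'.ArrowAt u v ↔ G.ArrowAt a v) ∧
      Relation.ReflTransGen (G.DartStep C) (u, b) (a, v) := by
    intro u v huv
    by_cases hG : G.Adj u v
    · exact ⟨v, u, hG, addBi_arrowAt_iff (adj_symm hG), addBi_arrowAt_iff hG,
        Relation.ReflTransGen.refl⟩
    have hnew : (u = i ∧ v = j) ∨ (u = j ∧ v = i) := by
      rcases huv with h | h | h | h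
      · exact absurd (Or.inl h) hG
      · exact absurd (Or.inr (Or.inl h)) hG
      · exact absurd (Or.inr (Or.inr h)) hG
      · exact h
    have hb : G'.bi u v := Or.inr hnew
    have hb' : G'.bi v u := G'.bi_symm _ _ hb
    rcases hnew with ⟨rfl, rfl⟩ | ⟨rfl, rfl⟩
    · obtain ⟨b, a, h1, h2, h3, h4⟩ := hwalk
      exact ⟨b, a, h1, iff_of_true (Or.inr hb') h2, iff_of_true (Or.inr hb) h3, h4⟩
    · obtain ⟨b, a, h1, h2, h3, h4⟩ := hwalk'
      exact ⟨b, a, h1, iff_of_true (Or.inr hb') h2, iff_of_true (Or.inr hb) h3, h4⟩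
  have key : ∀ t, t < n → ∃ b a, G.Adj x b ∧
      (G'.ArrowAt (f t) (f (t + 1)) ↔ G.ArrowAt a (f (t + 1))) ∧
      Relation.ReflTransGen (G.DartStep C) (x, b) (a, f (t + 1)) := by
    intro t
    induction t with
    | zero =>
      intro ht
      obtain ⟨b, a, h1, _, h3, h4⟩ := hedge _ _ (hpadj 0 ht)
      rw [h0] at h1 h4
      exact ⟨b, a, h1, h3, h4⟩
    | succ t ih =>
      intro ht
      obtain ⟨b, a, h1, h2, h3⟩ := ih (by omega)
      obtain ⟨b', a', h1', h2', h3', h4'⟩ := hedge _ _ (hpadj (t + 1) ht)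
      exact ⟨b, a', h1, h3', (h3.tail ⟨rfl, h1', (addBi_openAt_iff h2 h2').1
        (hm (t + 1) (by omega) ht)⟩).trans h4'⟩
  obtain ⟨m, rfl⟩ : ∃ m, n = m + 1 := ⟨n - 1, by omega⟩
  obtain ⟨b, a, h1, _, h3⟩ := key m (by omega)
  rw [hfn] at h3
  obtain ⟨k, g, g0, _, gk, gadj, gm⟩ := exists_walk_of_dartSteps h1 h3
  exact exists_path_of_walk hxy (k + 1) g g0 gk gadj gm h

end AddBi

end AncestralGraph

open AncestralGraph in
/-- **Richardson–Spirtes: maximal completion preserves the independence model.**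
If `i` and `j` are non-adjacent in a directed ancestral graph `G` on `Fin p` and no
set `C ⊆ Fin p \ {i, j}` m-separates them, then adding the bidirected edge
`i ↔ j` yields a directed ancestral graph with exactly the same m-separation
triples as `G`. -/
theorem maximal_completion {p : ℕ} (G : AncestralGraph (Fin p)) (i j : Fin p)
    (hij : i ≠ j) (hadj : ¬ G.Adj i j)
    (hnosep : ∀ C : Finset (Fin p), i ∉ C → j ∉ C → ¬ G.MSep i j C) :
    ∃ G' : AncestralGraph (Fin p),
      G'.dir = G.dir ∧
      (G'.bi = fun a b => G.bi a b ∨ (a = i ∧ b = j) ∨ (a = j ∧ b = i)) ∧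
      G'.MIndep = G.MIndep := by
  obtain ⟨hnij, hnji, n, f, hn, h0, hfn, hbi, hanc⟩ := exists_inducing_path hadj hnosep
  refine ⟨G.addBi i j hadj hnij hnji, rfl, rfl, ?_⟩
  ext ⟨x, y, C⟩
  refine and_congr_right fun hxy => and_congr_right fun _ => and_congr_right fun _ =>
    ⟨mSep_of_addBi_mSep, addBi_mSep_of_mSep hxy
      (exists_dartSteps_of_inducing hn h0 hfn hbi hanc) ?_⟩
  refine exists_dartSteps_of_inducing (n := n) (f := fun t => f (n - t)) hn (by simpa using hfn)
    (by simpa using h0) (fun t ht => ?_) fun t ht0 ht => (hanc _ (by omega) (by omega)).symm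
  have h := G.bi_symm _ _ (hbi (n - (t + 1)) (by omega))
  rwa [show n - (t + 1) + 1 = n - t by omega] at h

end CausalDiscovery
end
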